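/- arXiv:math/0005311 — 2 statements merged into one kernel-verified Lean document; each statement's English description precedes it below -/
import Mathlib

section
/- Let F/K be an extension of fields and v a valuation of F which is trivial on K and whose residue field equals K (via the restriction of the residue map to K). Then the restriction map res : G(F) → G(K) on absolute Galois groups is a continuous epimorphism which has a continuous group-theoretic section. -/
section
open Polynomial
set_option linter.unusedSectionVars false
section
variable {K₀ Ω Γ₀ : Type*} [Field K₀] [Field Ω] [Algebra K₀ Ω]
  [LinearOrderedCommGroupWithZero Γ₀] (w : Valuation Ω Γ₀)

theorem exists_primitive {x : Ω} (hx : IsAlgebraic K₀ x) :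
    ∃ f : K₀[X], aeval x f = 0 ∧ (∀ i, w (algebraMap K₀ Ω (f.coeff i)) ≤ 1) ∧
      ∃ j, w (algebraMap K₀ Ω (f.coeff j)) = 1 := by
  obtain ⟨f, hf0, hf⟩ := hx
  have hne : f.support.Nonempty := by simpa [Polynomial.support_nonempty] using hf0
  obtain ⟨j, hj, hmax⟩ := f.support.exists_max_image
    (fun i => w (algebraMap K₀ Ω (f.coeff i))) hne
  have hj0 : f.coeff j ≠ 0 := by simpa using hj
  have hwj : w (algebraMap K₀ Ω (f.coeff j)) ≠ 0 := by simpa using hj0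
  refine ⟨C (f.coeff j)⁻¹ * f, by simp [hf], fun i => ?_, j, ?_⟩
  · rw [coeff_C_mul, map_mul, map_mul, map_inv₀, map_inv₀]
    by_cases hi : f.coeff i = 0
    · simp [hi]
    · have := hmax i (by simpa using hi)
      rw [inv_mul_le_iff₀ (zero_lt_iff.mpr hwj)]; simpa using this
  · rw [coeff_C_mul, map_mul, map_mul, map_inv₀, map_inv₀, inv_mul_cancel₀ hwj]

theorem val_le_one_of_isIntegral_field (hK : ∀ a : K₀, a ≠ 0 → w (algebraMap K₀ Ω a) = 1)
    {b : Ω} (hb : IsAlgebraic K₀ b) : w b ≤ 1 := by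
  obtain ⟨f, hm, hf⟩ := isAlgebraic_iff_isIntegral.mp hb
  by_contra! h
  have hc : ∀ i, w (algebraMap K₀ Ω (f.coeff i)) ≤ 1 := fun i => by
    by_cases h0 : f.coeff i = 0
    · simp [h0]
    · exact (hK _ h0).le
  rw [eval₂_eq_sum_range, Finset.sum_range_succ, hm.coeff_natDegree] at hf
  have h1 : w (∑ i ∈ Finset.range f.natDegree, algebraMap K₀ Ω (f.coeff i) * b ^ i)
      < w b ^ f.natDegree := by
    apply Valuation.map_sum_lt
    · exact pow_ne_zero _ (fun h0 => by simp [h0] at h)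
    · intro i hi
      rw [map_mul, map_pow]
      calc _ ≤ 1 * w b ^ i := by gcongr; exact hc i
        _ = w b ^ i := one_mul _
        _ < _ := pow_lt_pow_right₀ h (Finset.mem_range.mp hi)
  have h2 := eq_neg_of_add_eq_zero_left hf
  rw [h2] at h1
  simp at h1

theorem val_eq_one_of_isAlgebraic (hK : ∀ a : K₀, a ≠ 0 → w (algebraMap K₀ Ω a) = 1)
    {b : Ω} (hb : IsAlgebraic K₀ b) (h0 : b ≠ 0) : w b = 1 := by
  apply le_antisymm (val_le_one_of_isIntegral_field w hK hb)
  have := val_le_one_of_isIntegral_field w hK hb.inv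
  rw [map_inv₀] at this
  exact (inv_le_one₀ (zero_lt_iff.mpr (by simpa using h0))).mp this
end

section
variable {K F Ω Γ₀ : Type*} [Field K] [Field F] [Field Ω] [Algebra K F] [Algebra F Ω]
  [Algebra K Ω] [IsScalarTower K F Ω] [IsAlgClosed Ω] [Algebra.IsAlgebraic F Ω]
  [LinearOrderedCommGroupWithZero Γ₀] (w : Valuation Ω Γ₀)

theorem exists_rho (hK : ∀ a : K, a ≠ 0 → w (algebraMap K Ω a) = 1)
    (hF : ∀ x : F, w (algebraMap F Ω x) ≤ 1 →
      ∃ a : K, w (algebraMap F Ω x - algebraMap K Ω a) < 1)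
    (x : Ω) (hx : w x ≤ 1) : ∃ b : Ω, IsAlgebraic K b ∧ w (x - b) < 1 := by
  obtain ⟨f, hf, hle, j, hj⟩ := exists_primitive w (Algebra.IsAlgebraic.isAlgebraic (R := F) x)
  choose a ha using fun i => hF (f.coeff i) (hle i)
  let g : K[X] := ∑ i ∈ Finset.range (f.natDegree + 1), monomial i (a i)
  have hjn : j ∈ Finset.range (f.natDegree + 1) := by
    rw [Finset.mem_range, Nat.lt_succ_iff]
    apply le_natDegree_of_ne_zero
    intro h0; simp [h0] at hj
  have hgj : g.coeff j = a j := by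
    simp only [g, finset_sum_coeff, coeff_monomial]
    rw [Finset.sum_ite_eq' , if_pos hjn]
  have hg0 : g ≠ 0 := by
    intro h0
    have h1 := ha j
    rw [← hgj, h0] at h1
    simp [hj] at h1
  have hgx : w (aeval x g) < 1 := by
    have h1 : aeval x g = aeval x g - aeval x f := by rw [hf, sub_zero]
    rw [h1, aeval_eq_sum_range (p := f)]
    simp only [g, map_sum, aeval_monomial]
    rw [← Finset.sum_sub_distrib]
    apply Valuation.map_sum_lt _ one_ne_zero
    intro i _
    rw [Algebra.smul_def, ← sub_mul, map_mul, Valuation.map_sub_swap]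
    exact mul_lt_one_of_lt_of_le (ha i) (by rw [map_pow]; exact pow_le_one' hx _)
  have hs : (g.map (algebraMap K Ω)).Splits := IsAlgClosed.splits _
  have h2 := hs.eq_prod_roots
  rw [← eval_map_algebraMap, h2, eval_mul, eval_C, map_mul, leadingCoeff_map,
    hK _ (leadingCoeff_ne_zero.mpr hg0), one_mul, eval_multiset_prod, Multiset.map_map] at hgx
  by_contra! hcon
  refine absurd hgx (not_lt.mpr ?_)
  rw [map_multiset_prod, Multiset.map_map]
  apply Multiset.one_le_prod
  intro y hy
  obtain ⟨b, hb, rfl⟩ := Multiset.mem_map.mp hy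
  simp only [Function.comp, eval_sub, eval_X, eval_C]
  apply hcon
  refine ⟨g, hg0, ?_⟩
  rw [mem_roots (by simpa using hg0), IsRoot.def, eval_map_algebraMap] at hb
  exact hb
end
end

section
open Polynomial
set_option linter.unusedSectionVars false
section
variable {K F Ω Γ₀ : Type*} [Field K] [Field F] [Field Ω] [Algebra K F] [Algebra F Ω]
  [Algebra K Ω] [IsScalarTower K F Ω] [IsAlgClosed Ω] [Algebra.IsAlgebraic F Ω]
  [LinearOrderedCommGroupWithZero Γ₀]

/-- residues of `E` are purely inseparable over `K` -/
def ResPI (K : Type*) {F Ω Γ₀ : Type*} [Field K] [Field F] [Field Ω] [Algebra F Ω]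
    [Algebra K Ω] [LinearOrderedCommGroupWithZero Γ₀] (w : Valuation Ω Γ₀)
    (E : IntermediateField F Ω) : Prop :=
  ∀ x ∈ E, w x ≤ 1 → ∃ b ∈ perfectClosure K Ω, w (x - b) < 1

variable (w : Valuation Ω Γ₀)

theorem exists_maximal_ResPI
    (hF : ∀ x : F, w (algebraMap F Ω x) ≤ 1 →
      ∃ a : K, w (algebraMap F Ω x - algebraMap K Ω a) < 1) :
    ∃ E : IntermediateField F Ω, ResPI K w E ∧ ∀ E', E ≤ E' → ResPI K w E' → E' ≤ E := by
  have hbot : ResPI K w (⊥ : IntermediateField F Ω) := by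
    intro x hx hx1
    obtain ⟨y, rfl⟩ := IntermediateField.mem_bot.mp hx
    obtain ⟨a, ha⟩ := hF y hx1
    exact ⟨_, (perfectClosure K Ω).algebraMap_mem a, ha⟩
  obtain ⟨E, -, hE⟩ := zorn_le_nonempty₀ {E : IntermediateField F Ω | ResPI K w E} (by
    intro c hc hchain y hy
    refine ⟨sSup c, ?_, fun z hz => le_sSup hz⟩
    intro x hx hx1
    have hdir : DirectedOn (· ≤ ·) c := hchain.directedOn
    have : Nonempty c := ⟨⟨y, hy⟩⟩
    rw [sSup_eq_iSup', ← SetLike.mem_coe,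
      IntermediateField.coe_iSup_of_directed hdir.directed_val, Set.mem_iUnion] at hx
    obtain ⟨⟨z, hz⟩, hxz⟩ := hx
    exact hc hz x hxz hx1) ⊥ hbot
  exact ⟨E, hE.prop, fun E' h h' => hE.le_of_ge h' h⟩

variable {w} {E : IntermediateField F Ω}

/-- specialised maximality: a field `E(b)` -/
theorem mem_of_adjoin (hmax : ∀ E', E ≤ E' → ResPI K w E' → E' ≤ E) (b : Ω)
    (h : ∀ g : E[X], w (aeval b g) ≤ 1 → ∃ c ∈ perfectClosure K Ω, w (aeval b g - c) < 1) :
    b ∈ E := by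
  let E' := (IntermediateField.adjoin E {b}).restrictScalars F
  have h1 : E ≤ E' := by
    intro x hx
    exact (IntermediateField.adjoin E {b}).algebraMap_mem ⟨x, hx⟩
  refine hmax E' h1 ?_ (IntermediateField.mem_adjoin_simple_self E b)
  intro x hx hx1
  have hx' : x ∈ IntermediateField.adjoin E {b} := hx
  have hbint : IsAlgebraic E b :=
    (Algebra.IsAlgebraic.isAlgebraic (R := F) b).tower_top E
  rw [← IntermediateField.mem_toSubalgebra,
    IntermediateField.adjoin_simple_toSubalgebra_of_isAlgebraic hbint,
    Algebra.adjoin_singleton_eq_range_aeval] at hx'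
  obtain ⟨g, rfl⟩ := hx'
  exact h g hx1

theorem perfectClosure_root {K Ω : Type*} [Field K] [Field Ω] [Algebra K Ω] [IsAlgClosed Ω] (q : ℕ)
    [ExpChar K q] {a : Ω} (ha : a ∈ perfectClosure K Ω) (n : ℕ) :
    ∃ b ∈ perfectClosure K Ω, b ^ q ^ n = a := by
  have hq : 0 < q ^ n := pow_pos (expChar_pos K q) _
  obtain ⟨b, hb⟩ := IsAlgClosed.exists_pow_nat_eq a hq
  refine ⟨b, ?_, hb⟩
  rw [mem_perfectClosure_iff_pow_mem q] at ha ⊢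
  obtain ⟨m, hm⟩ := ha
  refine ⟨n + m, ?_⟩
  rwa [pow_add, pow_mul, hb]

theorem ResPI.perfect (hE : ResPI K w E) (hmax : ∀ E', E ≤ E' → ResPI K w E' → E' ≤ E) :
    perfectClosure E Ω = ⊥ := by
  rw [eq_bot_iff]
  intro x hx
  obtain ⟨q, hq⟩ := ExpChar.exists K
  have : ExpChar Ω q := expChar_of_injective_algebraMap (algebraMap K Ω).injective q
  have : ExpChar F q := expChar_of_injective_algebraMap (algebraMap K F).injective q
  have : ExpChar E q := expChar_of_injective_algebraMap (algebraMap F E).injective q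
  suffices x ∈ E from IntermediateField.mem_bot.mpr ⟨⟨x, this⟩, rfl⟩
  refine mem_of_adjoin hmax x fun g hg => ?_
  have hy : aeval x g ∈ perfectClosure E Ω := by
    have := (aeval (⟨x, hx⟩ : perfectClosure E Ω) g).2
    rwa [← IntermediateField.coe_val, ← AlgHom.comp_apply, ← aeval_algHom,
      IntermediateField.coe_val] at this
  generalize aeval x g = y at hg hy
  rw [mem_perfectClosure_iff_pow_mem q] at hy
  obtain ⟨n, ⟨z, hz⟩⟩ := hy
  have hn : q ^ n ≠ 0 := (pow_pos (expChar_pos K q) _).ne'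
  obtain ⟨a, ha, haw⟩ := hE z z.2 (by
    change w (algebraMap E Ω z) ≤ 1
    rw [hz, map_pow]; exact pow_le_one' hg _)
  obtain ⟨b, hb, rfl⟩ := perfectClosure_root q ha n
  refine ⟨b, hb, ?_⟩
  change w (algebraMap E Ω z - _) < 1 at haw
  rw [hz, ← sub_pow_expChar_pow, map_pow] at haw
  exact (pow_lt_one_iff hn).mp haw

theorem ResPI.perfectClosure_le (hp : perfectClosure E Ω = ⊥) {b : Ω}
    (hb : b ∈ perfectClosure K Ω) : b ∈ E := by
  obtain ⟨q, hq⟩ := ExpChar.exists K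
  have : ExpChar F q := expChar_of_injective_algebraMap (algebraMap K F).injective q
  have : ExpChar E q := expChar_of_injective_algebraMap (algebraMap F E).injective q
  have : b ∈ perfectClosure E Ω := by
    rw [mem_perfectClosure_iff_pow_mem q] at hb ⊢
    obtain ⟨n, a, ha⟩ := hb
    exact ⟨n, algebraMap F E (algebraMap K F a), by
      rw [← ha, ← IsScalarTower.algebraMap_apply F E Ω, ← IsScalarTower.algebraMap_apply K F Ω]⟩
  rw [hp] at this
  obtain ⟨y, rfl⟩ := IntermediateField.mem_bot.mp this
  exact y.2

/-- best approximation -/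
theorem ResPI.best (hE : ResPI K w E) (hmax : ∀ E', E ≤ E' → ResPI K w E' → E' ≤ E) (a : Ω) :
    ∃ c ∈ E, ∀ c' ∈ E, w (a - c) ≤ w (a - c') := by
  let P : Set Ω := {b | ∀ c ∈ E, w (a - b) ≤ w (a - c)}
  have hne : ∃ n, ∃ b ∈ P, (minpoly E b).natDegree = n :=
    ⟨_, a, fun c _ => by simp, rfl⟩
  classical
  obtain ⟨b, hbP, hbn⟩ := Nat.find_spec hne
  have hmin := fun (b' : Ω) (hb' : b' ∈ P) =>
    hbn.le.trans (Nat.find_min' hne ⟨b', hb', rfl⟩)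
  have halg : ∀ y : Ω, IsAlgebraic E y := fun y =>
    (Algebra.IsAlgebraic.isAlgebraic (R := F) y).tower_top E
  refine ⟨b, ?_, hbP⟩
  refine mem_of_adjoin hmax b fun g₀ hg₀ => ?_
  have hbint : IsIntegral E b := (halg b).isIntegral
  -- reduce the degree
  obtain ⟨g, hgd, hgg⟩ : ∃ g : E[X], g.natDegree < (minpoly E b).natDegree ∧
      aeval b g₀ = aeval b g := by
    refine ⟨g₀ %ₘ minpoly E b, natDegree_modByMonic_lt _ (minpoly.monic hbint) ?_, ?_⟩
    · exact minpoly.ne_one E b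
    · rw [aeval_modByMonic_eq_self_of_root (minpoly.aeval E b)]
  rw [hgg] at hg₀ ⊢
  by_cases hg0 : g = 0
  · exact ⟨0, zero_mem _, by simp [hg0]⟩
  have hfar : ∀ y ∈ (g.map (algebraMap E Ω)).roots, ∃ c ∈ E, w (b - c) < w (b - y) := by
    intro y hy
    have hyP : y ∉ P := by
      intro hyP
      have h1 := hmin y hyP
      have h2 : aeval y g = 0 := by
        rw [mem_roots (by simpa using hg0), IsRoot.def, eval_map_algebraMap] at hy
        exact hy
      have h3 := natDegree_le_of_dvd (minpoly.dvd E y h2) hg0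
      omega
    simp only [P, Set.mem_ofPred_eq, not_forall, not_le] at hyP
    obtain ⟨c, hc, hlt⟩ := hyP
    refine ⟨c, hc, ?_⟩
    have h1 : w (b - c) ≤ w (a - c) := by
      have : b - c = (a - c) - (a - b) := by ring
      rw [this]
      exact (w.map_sub _ _).trans (max_le le_rfl (hbP c hc))
    have h2 : w (b - y) = w (a - y) := by
      have : b - y = (a - y) - (a - b) := by ring
      rw [this]
      exact Valuation.map_sub_eq_of_lt_left _ ((hbP c hc).trans_lt hlt)
    rw [h2]; exact h1.trans_lt hlt
  -- a common c
  obtain ⟨c, hc, hcy⟩ : ∃ c ∈ E, ∀ y ∈ (g.map (algebraMap E Ω)).roots, w (b - c) < w (b - y) := by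
    generalize (g.map (algebraMap E Ω)).roots = s at hfar
    induction s using Multiset.induction_on with
    | empty => exact ⟨0, zero_mem _, by simp⟩
    | cons y s ih =>
      obtain ⟨c₁, hc₁, h₁⟩ := ih fun z hz => hfar z (Multiset.mem_cons_of_mem hz)
      obtain ⟨c₂, hc₂, h₂⟩ := hfar y (Multiset.mem_cons_self _ _)
      rcases le_total (w (b - c₁)) (w (b - c₂)) with h | h
      · refine ⟨c₁, hc₁, fun z hz => ?_⟩
        rcases Multiset.mem_cons.mp hz with rfl | hz
        · exact h.trans_lt h₂
        · exact h₁ z hz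
      · refine ⟨c₂, hc₂, fun z hz => ?_⟩
        rcases Multiset.mem_cons.mp hz with rfl | hz
        · exact h₂
        · exact h.trans_lt (h₁ z hz)
  -- compare g(b) and g(c)
  have key : w (aeval c g - aeval b g) < w (aeval b g) ∧ aeval b g ≠ 0 := by
    have hs : (g.map (algebraMap E Ω)).Splits := IsAlgClosed.splits _
    have h2 := hs.eq_prod_roots
    rw [← eval_map_algebraMap, ← eval_map_algebraMap, h2]
    simp only [eval_mul, eval_C, eval_multiset_prod, Multiset.map_map, leadingCoeff_map,
      Function.comp, eval_sub, eval_X]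
    have hl : algebraMap E Ω g.leadingCoeff ≠ 0 := by simpa using hg0
    have aux : w ((Multiset.map (fun y => c - y) (g.map (algebraMap E Ω)).roots).prod -
        (Multiset.map (fun y => b - y) (g.map (algebraMap E Ω)).roots).prod) <
        w (Multiset.map (fun y => b - y) (g.map (algebraMap E Ω)).roots).prod ∧
        (Multiset.map (fun y => b - y) (g.map (algebraMap E Ω)).roots).prod ≠ 0 := by
      generalize (g.map (algebraMap E Ω)).roots = s at hcy
      induction s using Multiset.induction_on with
      | empty => simp
      | cons y s ih =>
        obtain ⟨ih1, ih2⟩ := ih fun z hz => hcy z (Multiset.mem_cons_of_mem hz)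
        have hy := hcy y (Multiset.mem_cons_self _ _)
        have hy0 : b - y ≠ 0 := by intro h0; simp [h0] at hy
        simp only [Multiset.map_cons, Multiset.prod_cons]
        refine ⟨?_, mul_ne_zero hy0 ih2⟩
        set p := (Multiset.map (fun y => c - y) s).prod
        set r := (Multiset.map (fun y => b - y) s).prod
        have hcb : w (c - y) = w (b - y) := by
          have : c - y = (b - y) - (b - c) := by ring
          rw [this]; exact Valuation.map_sub_eq_of_lt_left _ hy
        have hpos : 0 < w (b - y) := zero_lt_iff.mpr (by simpa using hy0)
        have hr : 0 < w r := zero_lt_iff.mpr (by simpa using ih2)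
        have : (c - y) * p - (b - y) * r = (c - y) * (p - r) - (b - c) * r := by ring
        rw [this, map_mul]
        refine (w.map_sub _ _).trans_lt (max_lt ?_ ?_)
        · rw [map_mul, hcb]; exact mul_lt_mul_of_pos_left ih1 hpos
        · rw [map_mul]; exact mul_lt_mul_of_pos_right hy hr
    refine ⟨?_, mul_ne_zero hl aux.2⟩
    change w (algebraMap E Ω g.leadingCoeff * _ - algebraMap E Ω g.leadingCoeff * _) < _
    rw [← mul_sub, map_mul, map_mul]
    exact mul_lt_mul_of_pos_left aux.1 (zero_lt_iff.mpr (by simpa using hl))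
  have hgc : aeval c g ∈ E := by
    have h1 := aeval_algebraMap_apply Ω (⟨c, hc⟩ : E) g
    have h2 : algebraMap E Ω ⟨c, hc⟩ = c := rfl
    rw [h2] at h1
    rw [h1]; exact (aeval (⟨c, hc⟩ : E) g).2
  have hgc1 : w (aeval c g) ≤ 1 := by
    have : aeval c g = aeval b g + (aeval c g - aeval b g) := by ring
    rw [this, Valuation.map_add_eq_of_lt_left _ key.1]
    exact hg₀
  obtain ⟨d, hd, hdw⟩ := hE _ hgc hgc1
  refine ⟨d, hd, ?_⟩
  have : aeval b g - d = (aeval c g - d) - (aeval c g - aeval b g) := by ring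
  rw [this]
  exact (w.map_sub _ _).trans_lt (max_lt hdw (key.1.trans_le hg₀))
end
end

section
open Polynomial
set_option linter.unusedSectionVars false
section
variable {K F Ω Γ₀ : Type*} [Field K] [Field F] [Field Ω] [Algebra K F] [Algebra F Ω]
  [Algebra K Ω] [IsScalarTower K F Ω] [IsAlgClosed Ω] [Algebra.IsAlgebraic F Ω]
  [LinearOrderedCommGroupWithZero Γ₀] {w : Valuation Ω Γ₀} {E : IntermediateField F Ω}

theorem val_sum_eq_of_distinct {ι : Type*} (w : Valuation Ω Γ₀) (s : Finset ι) (t : ι → Ω)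
    (hd : ∀ i ∈ s, ∀ k ∈ s, t i ≠ 0 → i ≠ k → w (t i) ≠ w (t k)) :
    ∀ i ∈ s, w (t i) ≤ w (∑ k ∈ s, t k) := by
  classical
  intro i hi
  obtain ⟨j, hj, hmax⟩ := s.exists_max_image (fun k => w (t k)) ⟨i, hi⟩
  refine (hmax i hi).trans ?_
  by_cases h0 : t j = 0
  · simp [h0]
  rw [← Finset.add_sum_erase s t hj, Valuation.map_add_eq_of_lt_left]
  apply Valuation.map_sum_lt _ (by simpa using h0)
  intro k hk
  have hk' := Finset.mem_erase.mp hk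
  exact lt_of_le_of_ne (hmax k hk'.2) fun h => hd j hj k hk'.2 h0 hk'.1.symm h.symm

theorem exists_pow_val {y : Ω} (hy : IsAlgebraic E y) (hy0 : y ≠ 0) :
    ∃ n : ℕ, 0 < n ∧ ∃ d ∈ E, w d = w y ^ n := by
  by_contra! hcon
  obtain ⟨f, hf0, hf⟩ := hy
  have key : ∀ i k, i < k → f.coeff i ≠ 0 → f.coeff k ≠ 0 →
      w (f.coeff i * y ^ i) ≠ w (f.coeff k * y ^ k) := by
    intro i k hik hi hk h
    refine hcon (k - i) (by omega) (f.coeff i / f.coeff k) (div_mem (f.coeff i).2 (f.coeff k).2) ?_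
    have hk' : w (f.coeff k : Ω) ≠ 0 := by simpa using hk
    have hy' : w y ≠ 0 := by simpa using hy0
    rw [map_div₀, div_eq_iff hk']
    rw [map_mul, map_mul, map_pow, map_pow] at h
    have hik' : w y ^ k = w y ^ (k - i) * w y ^ i := by rw [← pow_add]; congr 1; omega
    rw [hik', ← mul_assoc] at h
    rw [mul_right_cancel₀ (pow_ne_zero _ hy') h, mul_comm]
  have h1 := val_sum_eq_of_distinct w f.support (fun i => (f.coeff i : Ω) * y ^ i) (by
    intro i hi k hk _ hik
    rcases lt_or_gt_of_ne hik with h | h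
    · exact key i k h (by simpa using hi) (by simpa using hk)
    · exact (key k i h (by simpa using hk) (by simpa using hi)).symm)
  have h2 : ∑ k ∈ f.support, (f.coeff k : Ω) * y ^ k = 0 := by
    rw [aeval_def, eval₂_eq_sum, Polynomial.sum] at hf
    exact hf
  obtain ⟨j, hj⟩ := (Polynomial.support_nonempty (p := f)).mpr hf0
  have h3 := h1 j hj
  rw [h2, map_zero, le_zero_iff, map_mul, mul_eq_zero] at h3
  have hj' : f.coeff j ≠ 0 := by simpa using hj
  simp [hj', hy0] at h3

theorem ResPI.value (hE : ResPI K w E) (hmax : ∀ E', E ≤ E' → ResPI K w E' → E' ≤ E)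
    (y : Ω) (hy0 : y ≠ 0) : ∃ d ∈ E, w d = w y := by
  classical
  have hex := exists_pow_val (w := w) (E := E)
    ((Algebra.IsAlgebraic.isAlgebraic (R := F) y).tower_top E) hy0
  obtain ⟨hn, d, hd, hdw⟩ := Nat.find_spec hex
  have hmin := fun m (hm : m < Nat.find hex) => Nat.find_min hex hm
  set n := Nat.find hex
  obtain ⟨z, hz⟩ := IsAlgClosed.exists_pow_nat_eq d hn
  have hzw : w z = w y := by
    rw [← hz, map_pow] at hdw
    exact (pow_left_inj₀ zero_le zero_le hn.ne').mp hdw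
  refine ⟨z, ?_, hzw⟩
  have hz0 : w z ≠ 0 := by rw [hzw]; simpa using hy0
  refine mem_of_adjoin hmax z fun g₀ hg₀ => ?_
  obtain ⟨g, hgd, hgg⟩ : ∃ g : E[X], g.natDegree < n ∧ aeval z g₀ = aeval z g := by
    have hmon : (X ^ n - C (⟨d, hd⟩ : E)).Monic := monic_X_pow_sub_C _ hn.ne'
    have hdeg : (X ^ n - C (⟨d, hd⟩ : E)).natDegree = n := natDegree_X_pow_sub_C
    refine ⟨g₀ %ₘ (X ^ n - C (⟨d, hd⟩ : E)), ?_, ?_⟩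
    · refine (natDegree_modByMonic_lt _ hmon fun h => ?_).trans_eq hdeg
      rw [h, natDegree_one] at hdeg; omega
    · rw [aeval_modByMonic_eq_self_of_root]
      simp only [map_sub, map_pow, aeval_X, aeval_C]
      rw [hz]; exact sub_self _
  rw [hgg] at hg₀ ⊢
  have hsum : aeval z g = ∑ i ∈ Finset.range n, (g.coeff i : Ω) * z ^ i := by
    rw [aeval_eq_sum_range' hgd]; rfl
  rw [hsum] at hg₀ ⊢
  have key : ∀ i k, i < k → k < n → (g.coeff i : Ω) * z ^ i ≠ 0 →
      w (g.coeff i * z ^ i) ≠ w (g.coeff k * z ^ k) := by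
    intro i k hik hkn hi h
    refine hmin (k - i) (by omega) ⟨by omega, g.coeff i / g.coeff k,
      div_mem (g.coeff i).2 (g.coeff k).2, ?_⟩
    have hk' : w (g.coeff k : Ω) ≠ 0 := by
      intro h0
      rw [map_mul w (g.coeff k : Ω), h0, zero_mul] at h
      exact hi (w.zero_iff.mp h)
    rw [← hzw, map_div₀, div_eq_iff hk']
    rw [map_mul, map_mul, map_pow, map_pow] at h
    have hik' : w z ^ k = w z ^ (k - i) * w z ^ i := by rw [← pow_add]; congr 1; omega
    rw [hik', ← mul_assoc] at h
    rw [mul_right_cancel₀ (pow_ne_zero _ hz0) h, mul_comm]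
  have hterm : ∀ i ∈ Finset.range n, w ((g.coeff i : Ω) * z ^ i) ≤ 1 := fun i hi =>
    (val_sum_eq_of_distinct w (Finset.range n) (fun i => (g.coeff i : Ω) * z ^ i) (by
      intro i hi k hk h0 hik
      rcases lt_or_gt_of_ne hik with h | h
      · exact key i k h (Finset.mem_range.mp hk) h0
      · intro he
        refine key k i h (Finset.mem_range.mp hi) (fun h0' => ?_) he.symm
        rw [h0', map_zero] at he
        exact h0 (w.zero_iff.mp he)) i hi).trans hg₀
  have h0n : 0 ∈ Finset.range n := Finset.mem_range.mpr hn
  obtain ⟨b, hb, hbw⟩ := hE (g.coeff 0) (g.coeff 0).2 (by simpa using hterm 0 h0n)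
  refine ⟨b, hb, ?_⟩
  rw [← Finset.add_sum_erase _ _ h0n, pow_zero, mul_one, add_sub_right_comm]
  refine Valuation.map_add_lt _ hbw (Valuation.map_sum_lt _ one_ne_zero fun i hi => ?_)
  obtain ⟨hi0, hin⟩ := Finset.mem_erase.mp hi
  refine lt_of_le_of_ne (hterm i hin) fun h1 => ?_
  refine hmin i (Finset.mem_range.mp hin) ⟨Nat.pos_of_ne_zero hi0, (g.coeff i : Ω)⁻¹,
    inv_mem (g.coeff i).2, ?_⟩
  rw [map_mul, map_pow] at h1
  rw [map_inv₀, ← hzw, inv_eq_of_mul_eq_one_right h1]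

/-- The valuation ring is a localisation of the intersection of its conjugates. -/
theorem exists_fraction (x : Ω) (hx : w x ≤ 1)
    (hEinv : IsAlgebraic E x) :
    ∃ b : Ω, (∀ g : Ω ≃ₐ[E] Ω, w (g b) ≤ 1) ∧ (∀ g : Ω ≃ₐ[E] Ω, w (g (b * x)) ≤ 1) ∧ w b = 1 := by
  classical
  by_cases hx0 : x = 0
  · exact ⟨1, by simp, by simp [hx0], by simp⟩
  obtain ⟨f, hf, hle, hj⟩ := exists_primitive w hEinv
  have hne : (f.support.filter fun i => w (algebraMap E Ω (f.coeff i)) = 1).Nonempty := by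
    obtain ⟨j, hj⟩ := hj
    refine ⟨j, Finset.mem_filter.mpr ⟨?_, hj⟩⟩
    rw [mem_support_iff]; intro h0; simp [h0] at hj
  obtain ⟨j, hjm, hjmax⟩ := Finset.exists_max_image _ id hne
  obtain ⟨hjs, hj1⟩ := Finset.mem_filter.mp hjm
  have hjlt : ∀ i, j < i → w (algebraMap E Ω (f.coeff i)) < 1 := by
    intro i hi
    refine lt_of_le_of_ne (hle i) fun h1 => ?_
    have := hjmax i (Finset.mem_filter.mpr ⟨by
      rw [mem_support_iff]; intro h0; simp [h0] at h1, h1⟩)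
    simp at this; omega
  set a : ℕ → Ω := fun i => algebraMap E Ω (f.coeff i) with ha
  set N := f.natDegree
  have hjN : j ≤ N := le_natDegree_of_ne_zero (by simpa using hjs)
  let b := ∑ i ∈ Finset.range (N + 1 - j), a (j + i) * x ^ i
  have hb2 : b = -∑ i ∈ Finset.range j, a i * x⁻¹ ^ (j - i) := by
    have h1 : b * x ^ j + ∑ i ∈ Finset.range j, a i * x ^ i = 0 := by
      rw [← hf, aeval_eq_sum_range]
      have : N + 1 = j + (N + 1 - j) := by omega
      rw [this, Finset.sum_range_add, add_comm, Finset.sum_mul]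
      congr 1
      · exact Finset.sum_congr rfl fun i _ => by
          rw [Algebra.smul_def, pow_add]; simp only [ha]; ring
    have hxj : x ^ j ≠ 0 := pow_ne_zero _ hx0
    apply mul_right_cancel₀ hxj
    rw [eq_neg_of_add_eq_zero_left h1, neg_mul, Finset.sum_mul]
    congr 1
    refine Finset.sum_congr rfl fun i hi => ?_
    have hij : j = (j - i) + i := by have := Finset.mem_range.mp hi; omega
    conv_rhs => rw [hij, pow_add]
    simp only [Nat.add_sub_cancel]
    rw [mul_assoc, ← mul_assoc (x⁻¹ ^ _), ← mul_pow, inv_mul_cancel₀ hx0, one_pow, one_mul]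
  have hga : ∀ (g : Ω ≃ₐ[E] Ω) i, g (a i) = a i := fun g i => g.commutes _
  have hle' : ∀ i, w (a i) ≤ 1 := hle
  have case1 : ∀ g : Ω ≃ₐ[E] Ω, w (g x) ≤ 1 → w (g b) ≤ 1 := by
    intro g hg
    simp only [b, map_sum, map_mul, hga, map_pow]
    exact Valuation.map_sum_le _ fun i _ => by
      rw [map_mul, map_pow]; exact mul_le_one' (hle' _) (pow_le_one' hg _)
  have case2 : ∀ g : Ω ≃ₐ[E] Ω, 1 ≤ w (g x) → w (g (b * x)) ≤ 1 := by
    intro g hg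
    have h1 : b * x = -∑ i ∈ Finset.range j, a i * x⁻¹ ^ (j - i - 1) := by
      rw [hb2, neg_mul, Finset.sum_mul]
      congr 1
      refine Finset.sum_congr rfl fun i hi => ?_
      have hij : j - i = (j - i - 1) + 1 := by have := Finset.mem_range.mp hi; omega
      conv_lhs => rw [hij, pow_succ]
      rw [mul_assoc, mul_assoc, inv_mul_cancel₀ hx0, mul_one]
    rw [h1, map_neg, Valuation.map_neg]
    simp only [map_sum, map_mul, hga, map_pow, map_inv₀]
    refine Valuation.map_sum_le _ fun i _ => ?_
    rw [map_mul, map_pow, map_inv₀]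
    exact mul_le_one' (hle' _) (pow_le_one' (inv_le_one_of_one_le₀ hg) _)
  refine ⟨b, fun g => ?_, fun g => ?_, ?_⟩
  · rcases le_total (w (g x)) 1 with h | h
    · exact case1 g h
    · have := case2 g h
      rw [map_mul, map_mul] at this
      by_contra! hc
      exact absurd this (not_le.mpr (one_lt_mul_of_lt_of_le hc h))
  · rcases le_total (w (g x)) 1 with h | h
    · rw [map_mul, map_mul]; exact mul_le_one' (case1 g h) h
    · exact case2 g h
  · have hr : N + 1 - j = (N - j) + 1 := by omega
    have : b = (∑ i ∈ Finset.range (N - j), a (j + (i + 1)) * x ^ (i + 1)) + a j := by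
      simp only [b]; rw [hr, Finset.sum_range_succ']; simp
    rw [this, Valuation.map_add_eq_of_lt_right, hj1]
    · rw [hj1]
      refine Valuation.map_sum_lt _ one_ne_zero fun i _ => ?_
      rw [map_mul, map_pow]
      exact mul_lt_one_of_lt_of_le (hjlt _ (by omega)) (pow_le_one' hx _)
end
end

section
open Polynomial
set_option linter.unusedSectionVars false
section
open scoped Pointwise
variable {E Ω Γ₀ : Type*} [Field E] [Field Ω] [Algebra E Ω]
  [LinearOrderedCommGroupWithZero Γ₀]

/-- intersection of the conjugates of the valuation ring -/
def conjRing (E : Type*) {Ω Γ₀ : Type*} [Field E] [Field Ω] [Algebra E Ω]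
    [LinearOrderedCommGroupWithZero Γ₀] (w : Valuation Ω Γ₀) : Subring Ω where
  carrier := {x | ∀ g : Ω ≃ₐ[E] Ω, w (g x) ≤ 1}
  zero_mem' := fun g => by simp
  one_mem' := fun g => by simp
  add_mem' := fun {a b} ha hb g => by rw [map_add]; exact (w.map_add_le (ha g) (hb g))
  mul_mem' := fun {a b} ha hb g => by
    rw [map_mul, map_mul]; exact mul_le_one' (ha g) (hb g)
  neg_mem' := fun {a} ha g => by rw [map_neg, Valuation.map_neg]; exact ha g

instance conjRing_invariant (w : Valuation Ω Γ₀) :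
    IsInvariantSubring (Ω ≃ₐ[E] Ω) (conjRing E w) where
  smul_mem := fun m {x} hx g => hx (g * m)

/-- center of the valuation on `conjRing` -/
def conjIdeal (E : Type*) {Ω Γ₀ : Type*} [Field E] [Field Ω] [Algebra E Ω]
    [LinearOrderedCommGroupWithZero Γ₀] (w : Valuation Ω Γ₀) : Ideal (conjRing E w) where
  carrier := {x | w x < 1}
  zero_mem' := by simp
  add_mem' := fun {a b} ha hb => by exact w.map_add_lt ha hb
  smul_mem' := fun c x hx => by
    change w (c.1 * x.1) < 1
    rw [map_mul]
    exact (mul_le_of_le_one_left' (c.2 1)).trans_lt hx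

theorem mem_conjIdeal {w : Valuation Ω Γ₀} {x : conjRing E w} :
    x ∈ conjIdeal E w ↔ w x < 1 := Iff.rfl

instance conjIdeal_prime (w : Valuation Ω Γ₀) : (conjIdeal E w).IsPrime where
  ne_top' := by
    rw [Ideal.ne_top_iff_one, mem_conjIdeal]; simp
  mem_or_mem' := by
    intro x y h
    rw [mem_conjIdeal] at h ⊢
    rw [mem_conjIdeal]
    by_contra! hc
    have hx : w x = 1 := le_antisymm (x.2 1) hc.1
    have hy : w y = 1 := le_antisymm (y.2 1) hc.2
    simp [hx, hy] at h

theorem decomposition_lift [IsGalois E Ω] (w : Valuation Ω Γ₀) (kb : Subring Ω)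
    (hkw : ∀ b ∈ kb, b ≠ 0 → w b = 1)
    (hkg : ∀ g : Ω ≃ₐ[E] Ω, ∀ b ∈ kb, g b ∈ kb)
    (hres : ∀ x, w x ≤ 1 → ∃ b ∈ kb, w (x - b) < 1)
    (hresE : ∀ x : E, w (algebraMap E Ω x) ≤ 1 →
      ∃ b : E, algebraMap E Ω b ∈ kb ∧ w (algebraMap E Ω x - algebraMap E Ω b) < 1)
    (hfrac : ∀ x, w x ≤ 1 → ∃ b : Ω, (∀ g : Ω ≃ₐ[E] Ω, w (g b) ≤ 1) ∧
      (∀ g : Ω ≃ₐ[E] Ω, w (g (b * x)) ≤ 1) ∧ w b = 1)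
    (g : Ω ≃ₐ[E] Ω) :
    ∃ d : Ω ≃ₐ[E] Ω, (∀ x, w x ≤ 1 ↔ w (d x) ≤ 1) ∧ ∀ b ∈ kb, d b = g b := by
  let G := Ω ≃ₐ[E] Ω
  let B := conjRing E w
  let Q : Ideal B := conjIdeal E w
  let A := FixedPoints.subalgebra ℤ B G
  let P : Ideal A := Q.under A
  have hkle : ∀ b ∈ kb, w b ≤ 1 := fun b hb => by
    by_cases h : b = 0
    · simp [h]
    · exact (hkw b hb h).le
  have hkB : kb ≤ B := fun b hb g => hkle _ (hkg g b hb)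
  let _ : TopologicalSpace B := ⊥
  have : DiscreteTopology B := ⟨rfl⟩
  have : ContinuousSMul G B := by
    rw [continuousSMul_iff_stabilizer_isOpen]
    intro x
    convert stabilizer_isOpen_of_isIntegral (K := E) (L := Ω) x.1
    ext σ
    simp only [MulAction.mem_stabilizer_iff, SetLike.mem_coe]
    exact Subtype.ext_iff
  have : SMulCommClass G A B := ⟨fun σ a b => by
    change σ • (a.1 * b) = a.1 * (σ • b)
    rw [smul_mul', a.2 σ]⟩
  have : Algebra.IsInvariant A B G := ⟨fun b hb => ⟨⟨b, hb⟩, rfl⟩⟩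
  have hsurj := Ideal.Quotient.stabilizerHom_surjective_of_profinite (G := G) P Q
  -- the isomorphism kb ≃ B/Q
  let φ₀ : kb →+* B ⧸ Q := (Ideal.Quotient.mk Q).comp (Subring.inclusion hkB)
  have hφ : Function.Bijective φ₀ := by
    constructor
    · rw [injective_iff_map_eq_zero]
      intro b hb
      have := Ideal.Quotient.eq_zero_iff_mem.mp hb
      by_contra h0
      have h1 := hkw b b.2 (by simpa using h0)
      exact absurd (mem_conjIdeal.mp this) (by simp [Subring.inclusion, h1])
    · intro y
      obtain ⟨x, rfl⟩ := Ideal.Quotient.mk_surjective y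
      obtain ⟨b, hb, hxb⟩ := hres x (x.2 1)
      refine ⟨⟨b, hb⟩, ?_⟩
      refine ((Ideal.Quotient.mk_eq_mk_iff_sub_mem _ _).mpr ?_).symm
      exact hxb
  let φ := RingEquiv.ofBijective φ₀ hφ
  let γ₀ : kb →+* kb := (g : Ω →+* Ω).restrict kb kb (fun b hb => hkg g b hb)
  have hγ : Function.Bijective γ₀ := by
    constructor
    · intro x y h
      exact Subtype.ext (g.injective (congrArg Subtype.val h))
    · intro y
      exact ⟨⟨g.symm y, hkg g.symm y y.2⟩, Subtype.ext (g.apply_symm_apply _)⟩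
  let γ := RingEquiv.ofBijective γ₀ hγ
  let σ : (B ⧸ Q) ≃ₐ[A ⧸ P] (B ⧸ Q) := AlgEquiv.ofRingEquiv (f := (φ.symm.trans γ).trans φ) (by
    intro r
    obtain ⟨a, rfl⟩ := Ideal.Quotient.mk_surjective r
    have haE : ∃ e : E, algebraMap E Ω e = a.1.1 := by
      rw [← Set.mem_range, InfiniteGalois.mem_range_algebraMap_iff_fixed]
      intro τ
      exact congrArg Subtype.val (a.2 τ)
    obtain ⟨e, he⟩ := haE
    obtain ⟨b, hbk, hb⟩ := hresE e (by rw [he]; exact a.1.2 1)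
    have h1 : algebraMap (A ⧸ P) (B ⧸ Q) (Ideal.Quotient.mk P a) = φ ⟨_, hbk⟩ := by
      refine (Ideal.Quotient.mk_eq_mk_iff_sub_mem _ _).mpr ?_
      rw [he] at hb
      exact hb
    rw [h1]
    simp only [RingEquiv.trans_apply, RingEquiv.symm_apply_apply]
    congr 1
    exact Subtype.ext (g.commutes b))
  obtain ⟨d, hd⟩ := hsurj σ
  have hdQ : ∀ d : MulAction.stabilizer G Q, ∀ x ∈ B, w x < 1 ↔ w (d.1 x) < 1 := by
    intro d x hx
    have h1 : (d.1 • Q) = Q := d.2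
    have := Ideal.smul_mem_pointwise_smul_iff (a := d.1) (S := Q) (x := ⟨x, hx⟩)
    rw [h1] at this
    exact this.symm
  have hdO : ∀ d : MulAction.stabilizer G Q, ∀ x, w x ≤ 1 → w (d.1 x) ≤ 1 := by
    intro d x hx
    obtain ⟨b, hb, hbx, hb1⟩ := hfrac x hx
    have h1 : w (d.1 b) = 1 := by
      refine le_antisymm (hb _) (not_lt.mp fun h => ?_)
      exact absurd ((hdQ d b hb).mpr h) (by simp [hb1])
    have := hbx d.1
    rw [map_mul, map_mul, h1, one_mul] at this
    exact this
  refine ⟨d.1, fun x => ⟨hdO d x, fun h => ?_⟩, fun b hb => ?_⟩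
  · have := hdO d⁻¹ _ h
    have h2 : (d⁻¹).1 (d.1 x) = x := d.1.symm_apply_apply x
    rwa [h2] at this
  · have h1 := congrArg (fun s => s (φ ⟨b, hb⟩)) hd
    have h2 : σ (φ ⟨b, hb⟩) = φ (γ ⟨b, hb⟩) := by
      change φ (γ (φ.symm (φ ⟨b, hb⟩))) = _
      rw [RingEquiv.symm_apply_apply]
    have h3 : Ideal.Quotient.stabilizerHom Q P G d (φ ⟨b, hb⟩) = φ ⟨d.1 b, hkg _ b hb⟩ := rfl
    have h4 := h3.symm.trans (h1.trans h2)
    exact congrArg Subtype.val (φ.injective h4)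
end
end

section
open Polynomial
set_option linter.unusedSectionVars false
section
variable {K F Ω Γ₀ : Type*} [Field K] [Field F] [Field Ω] [Algebra K F] [Algebra F Ω]
  [Algebra K Ω] [IsScalarTower K F Ω] [IsAlgClosed Ω] [Algebra.IsAlgebraic F Ω]
  [LinearOrderedCommGroupWithZero Γ₀] {w : Valuation Ω Γ₀} {E : IntermediateField F Ω}

theorem ResPI.isGalois (hE : ResPI K w E) (hmax : ∀ E', E ≤ E' → ResPI K w E' → E' ≤ E) :
    IsGalois E Ω := by
  have : PerfectField E := perfectField_of_perfectClosure_eq_bot E Ω (hE.perfect hmax)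
  have : Algebra.IsAlgebraic E Ω := Algebra.IsAlgebraic.tower_top (K := F) E
  have : Normal E Ω := normal_iff.mpr fun x =>
    ⟨Algebra.IsIntegral.isIntegral x, IsAlgClosed.splits _⟩
  exact ⟨⟩

theorem rho_unique (hK : ∀ a : K, a ≠ 0 → w (algebraMap K Ω a) = 1) {b c : Ω}
    (hb : IsAlgebraic K b) (hc : IsAlgebraic K c) (h : w (b - c) < 1) : b = c := by
  by_contra hne
  have := val_eq_one_of_isAlgebraic w hK (hb.sub hc) (sub_ne_zero.mpr hne)
  exact absurd this h.ne

theorem isAlgebraic_gal (g : Ω ≃ₐ[E] Ω) {b : Ω} (hb : IsAlgebraic K b) : IsAlgebraic K (g b) :=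
  hb.algHom ((g.restrictScalars F).restrictScalars K).toAlgHom

theorem isAlgebraic_of_mem_perfectClosure {b : Ω} (hb : b ∈ perfectClosure K Ω) :
    IsAlgebraic K b := by
  have : Algebra.IsAlgebraic K (perfectClosure K Ω) := inferInstance
  exact IntermediateField.isAlgebraic_iff.mp (this.isAlgebraic ⟨b, hb⟩)

theorem ResPI.mem_perfectClosure (hK : ∀ a : K, a ≠ 0 → w (algebraMap K Ω a) = 1)
    (hE : ResPI K w E) {b : Ω} (hb : IsAlgebraic K b) (hbE : b ∈ E) : b ∈ perfectClosure K Ω := by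
  have hle : w b ≤ 1 := by
    by_cases h : b = 0
    · simp [h]
    · exact (val_eq_one_of_isAlgebraic w hK hb h).le
  obtain ⟨c, hc, hbc⟩ := hE b hbE hle
  rw [rho_unique hK hb (isAlgebraic_of_mem_perfectClosure hc) hbc]
  exact hc

theorem ResPI.invariant (hK : ∀ a : K, a ≠ 0 → w (algebraMap K Ω a) = 1)
    (hF : ∀ x : F, w (algebraMap F Ω x) ≤ 1 →
      ∃ a : K, w (algebraMap F Ω x - algebraMap K Ω a) < 1)
    (hE : ResPI K w E) (hmax : ∀ E', E ≤ E' → ResPI K w E' → E' ≤ E)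
    (g : Ω ≃ₐ[E] Ω) (x : Ω) : w x ≤ 1 ↔ w (g x) ≤ 1 := by
  have hgal := hE.isGalois hmax
  have hp := hE.perfect hmax
  let kb : Subring Ω := (algebraicClosure K Ω).toSubring
  have hkb : ∀ b, b ∈ kb ↔ IsAlgebraic K b := fun b => mem_algebraicClosure_iff
  have hlift := decomposition_lift (E := E) w kb
    (fun b hb h0 => val_eq_one_of_isAlgebraic w hK ((hkb b).mp hb) h0)
    (fun g b hb => (hkb _).mpr (isAlgebraic_gal g ((hkb b).mp hb)))
    (fun x hx => by
      obtain ⟨b, hb, h⟩ := exists_rho w hK hF x hx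
      exact ⟨b, (hkb b).mpr hb, h⟩)
    (fun x hx => by
      obtain ⟨b, hb, h⟩ := hE x x.2 hx
      exact ⟨⟨b, ResPI.perfectClosure_le hp hb⟩,
        (hkb b).mpr (isAlgebraic_of_mem_perfectClosure hb), h⟩)
    (fun x hx => exists_fraction x hx (Algebra.IsAlgebraic.isAlgebraic x))
  let D : Subgroup (Ω ≃ₐ[E] Ω) :=
    { carrier := {d | ∀ x, w x ≤ 1 ↔ w (d x) ≤ 1}
      one_mem' := fun x => Iff.rfl
      mul_mem' := fun {a b} ha hb x => (hb x).trans (ha (b x))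
      inv_mem' := fun {a} ha x => by
        have := ha (a⁻¹ x)
        rw [show a (a⁻¹ x) = x from a.apply_symm_apply x] at this
        exact this.symm }
  have hDclosed : IsClosed (D : Set (Ω ≃ₐ[E] Ω)) := by
    have : (D : Set (Ω ≃ₐ[E] Ω)) = ⋂ x : Ω, {d | w x ≤ 1 ↔ w (d x) ≤ 1} := by
      ext d; simp only [Set.mem_iInter]; rfl
    rw [this]
    refine isClosed_iInter fun x => ?_
    rw [← isOpen_compl_iff, isOpen_iff_mem_nhds]
    intro d hd
    have h1 := (stabilizer_isOpen_of_isIntegral (K := E) x).preimage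
      (continuous_const_mul d⁻¹)
    refine Filter.mem_of_superset (h1.mem_nhds (x := d) (by simp)) ?_
    intro τ hτ
    have hτ' : (d⁻¹ * τ) x = x := hτ
    have : τ x = d x := by
      have := congrArg d hτ'
      rwa [AlgEquiv.mul_apply, show d (d⁻¹ (τ x)) = τ x from d.apply_symm_apply _] at this
    simpa [this] using hd
  have hDtop : D = ⊤ := by
    have h1 := InfiniteGalois.fixingSubgroup_fixedField (⟨D, hDclosed⟩ : ClosedSubgroup (Ω ≃ₐ[E] Ω))
    have h2 : IntermediateField.fixedField D = ⊥ := by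
      rw [eq_bot_iff]
      intro y hy
      have hle := hmax ((IntermediateField.fixedField D).restrictScalars F)
        (fun z hz => (IntermediateField.fixedField D).algebraMap_mem ⟨z, hz⟩) ?_ hy
      · exact IntermediateField.mem_bot.mpr ⟨⟨y, hle⟩, rfl⟩
      intro x hx hx1
      have hxD : ∀ d ∈ D, d x = x := fun d hd => hx ⟨d, hd⟩
      obtain ⟨b, hb, hxb⟩ := exists_rho w hK hF x hx1
      have hbD : ∀ d ∈ D, d b = b := by
        intro d hd
        refine rho_unique hK (isAlgebraic_gal d hb) hb ?_
        have hlt : w (d (x - b)) < 1 := by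
          by_cases h0 : x - b = 0
          · simp [h0]
          by_contra! hc
          have h3 : w ((x - b)⁻¹) ≤ 1 := by
            rw [hd]; rw [map_inv₀, map_inv₀]; exact inv_le_one_of_one_le₀ hc
          rw [map_inv₀] at h3
          have h4 : w (x - b) ≠ 0 := by simpa using h0
          exact absurd h3 (not_le.mpr ((one_lt_inv₀ (zero_lt_iff.mpr h4)).mpr hxb))
        rw [map_sub, hxD d hd] at hlt
        have : d b - b = (x - b) - (x - d b) := by ring
        rw [this]
        exact w.map_sub_lt hxb hlt
      refine ⟨b, hE.mem_perfectClosure hK hb ?_, hxb⟩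
      have : b ∈ Set.range (algebraMap E Ω) := by
        rw [InfiniteGalois.mem_range_algebraMap_iff_fixed]
        intro g
        obtain ⟨d, hd, hdg⟩ := hlift g
        rw [← hdg b ((hkb b).mpr hb)]
        exact hbD d hd
      obtain ⟨e, rfl⟩ := this
      exact e.2
    change IntermediateField.fixingSubgroup (IntermediateField.fixedField D) = D at h1
    rw [← h1, h2, IntermediateField.fixingSubgroup_bot]
  have : g ∈ D := by rw [hDtop]; trivial
  exact this x

theorem ResPI.val_gal (hK : ∀ a : K, a ≠ 0 → w (algebraMap K Ω a) = 1)
    (hF : ∀ x : F, w (algebraMap F Ω x) ≤ 1 →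
      ∃ a : K, w (algebraMap F Ω x - algebraMap K Ω a) < 1)
    (hE : ResPI K w E) (hmax : ∀ E', E ≤ E' → ResPI K w E' → E' ≤ E)
    (g : Ω ≃ₐ[E] Ω) (x : Ω) : w (g x) = w x := by
  by_cases h0 : x = 0
  · simp [h0]
  obtain ⟨d, hd, hdx⟩ := hE.value hmax x h0
  have hx : w x ≠ 0 := by simpa using h0
  have hgd : g d = d := g.commutes ⟨d, hd⟩
  have hgx : w (g x) ≠ 0 := by simpa using h0
  apply le_antisymm
  · have := (hE.invariant hK hF hmax g (x / d)).mp (by rw [map_div₀, hdx, div_self hx])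
    rw [map_div₀, map_div₀, hgd, hdx] at this
    exact (div_le_one₀ (zero_lt_iff.mpr hx)).mp this
  · have := (hE.invariant hK hF hmax g (d / x)).mp (by rw [map_div₀, hdx, div_self hx])
    rw [map_div₀, map_div₀, hgd, hdx] at this
    exact (div_le_one₀ (zero_lt_iff.mpr hgx)).mp this
end
end

section
open Polynomial
set_option linter.unusedSectionVars false
section
variable {K F Ω Γ₀ : Type*} [Field K] [Field F] [Field Ω] [Algebra K F] [Algebra F Ω]
  [Algebra K Ω] [IsScalarTower K F Ω] [IsAlgClosed Ω] [Algebra.IsAlgebraic F Ω]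
  [LinearOrderedCommGroupWithZero Γ₀] {w : Valuation Ω Γ₀} {E : IntermediateField F Ω}

/-- a basis of constants for the constant extension -/
theorem exists_const_basis (n : Set Ω) (hn1 : (1 : Ω) ∈ n)
    (hnm : ∀ x ∈ n, ∀ y ∈ n, x * y ∈ n) [Algebra.IsAlgebraic E Ω]
    [FiniteDimensional E (IntermediateField.adjoin E n)] :
    ∃ (m : ℕ) (e : Module.Basis (Fin m) E (IntermediateField.adjoin E n)), ∀ i, (e i : Ω) ∈ n := by
  let E' := IntermediateField.adjoin E n
  let s : Set E' := {x | (x : Ω) ∈ n}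
  have hspan : Submodule.span E s = ⊤ := by
    have h1 : E'.toSubalgebra = Algebra.adjoin E n :=
      IntermediateField.adjoin_toSubalgebra_of_isAlgebraic fun x _ =>
        Algebra.IsAlgebraic.isAlgebraic x
    have h2 : Subalgebra.toSubmodule (Algebra.adjoin E n) = Submodule.span E n := by
      rw [Algebra.adjoin_eq_span]
      congr 1
      let S : Submonoid Ω := ⟨⟨n, fun {a b} ha hb => hnm a ha b hb⟩, hn1⟩
      exact congrArg (fun S : Submonoid Ω => (S : Set Ω)) (Submonoid.closure_eq S)
    have hsn : Set.image (E'.val.toLinearMap) s = n := by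
      ext x
      constructor
      · rintro ⟨y, hy, rfl⟩; exact hy
      · intro hx; exact ⟨⟨x, IntermediateField.subset_adjoin E n hx⟩, hx, rfl⟩
    rw [eq_top_iff]
    intro x _
    have hx : (x : Ω) ∈ Submodule.span E n := by
      rw [← h2, ← h1]; exact x.2
    rw [← hsn, Submodule.span_image] at hx
    obtain ⟨y, hy, hyx⟩ := hx
    have : y = x := Subtype.ext hyx
    rwa [← this]
  obtain ⟨t, hts, htspan, htli⟩ := exists_linearIndependent E s
  let e₀ : Module.Basis t E E' := Module.Basis.mk htli (by
    rw [Subtype.range_coe, htspan, hspan])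
  have : Finite t := Module.Finite.finite_basis e₀
  have : Fintype t := Fintype.ofFinite t
  refine ⟨Fintype.card t, e₀.reindex (Fintype.equivFin t), fun i => ?_⟩
  rw [Module.Basis.reindex_apply, Module.Basis.mk_apply]
  exact hts (Subtype.prop _)

theorem ResPI.mem_adjoin_const (hK : ∀ a : K, a ≠ 0 → w (algebraMap K Ω a) = 1)
    (hF : ∀ x : F, w (algebraMap F Ω x) ≤ 1 →
      ∃ a : K, w (algebraMap F Ω x - algebraMap K Ω a) < 1)
    (hE : ResPI K w E) (hmax : ∀ E', E ≤ E' → ResPI K w E' → E' ≤ E)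
    (a : Ω) : a ∈ IntermediateField.adjoin E {b : Ω | IsAlgebraic K b} := by
  classical
  have hgal := hE.isGalois hmax
  have hinv := hE.val_gal hK hF hmax
  let M := IntermediateField.adjoin E {a}
  have haM : a ∈ M := IntermediateField.mem_adjoin_simple_self E a
  have hMfin : FiniteDimensional E M := IntermediateField.adjoin.finiteDimensional
    (Algebra.IsIntegral.isIntegral a)
  let n : Set Ω := {b | IsAlgebraic K b ∧ b ∈ M}
  let E' := IntermediateField.adjoin E n
  have hE'M : E' ≤ M := IntermediateField.adjoin_le_iff.mpr fun b hb => hb.2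
  have hE'fin : FiniteDimensional E E' :=
    Module.Finite.of_injective (IntermediateField.inclusion hE'M).toLinearMap
      (IntermediateField.inclusion hE'M).injective
  obtain ⟨m, e, he⟩ := exists_const_basis (E := E) n ⟨isAlgebraic_one, one_mem _⟩
    (fun x hx y hy => ⟨hx.1.mul hy.1, mul_mem hx.2 hy.2⟩)
  have hkle : ∀ b : Ω, IsAlgebraic K b → w b ≤ 1 := fun b hb => by
    by_cases h : b = 0
    · simp [h]
    · exact (val_eq_one_of_isAlgebraic w hK hb h).le
  -- the embeddings
  have hcard : Fintype.card (Fin m) = Fintype.card (E' →ₐ[E] Ω) := by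
    rw [AlgHom.card, Module.finrank_eq_card_basis e]
  let ε : Fin m ≃ (E' →ₐ[E] Ω) := Fintype.equivOfCardEq hcard
  have hτ : ∀ j, ∃ τ : Ω ≃ₐ[E] Ω, ∀ x : E', τ x = ε j x := by
    intro j
    obtain ⟨f, hf⟩ := IsAlgClosed.surjective_domRestrict_of_isAlgebraic (K := E) (L := E')
      (E := Ω) (M := Ω) (ε j)
    refine ⟨AlgEquiv.ofBijective f (Algebra.IsAlgebraic.algHom_bijective f), fun x => ?_⟩
    rw [← hf]; rfl
  choose τ hτ using hτ
  let kb := algebraicClosure K Ω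
  let M' : Matrix (Fin m) (Fin m) kb := fun i j =>
    ⟨τ j (e i), mem_algebraicClosure_iff.mpr (isAlgebraic_gal (τ j) (he i).1)⟩
  have hdet : M'.det ≠ 0 := by
    intro h0
    have h1 := Algebra.discr_eq_det_embeddingsMatrixReindex_pow_two E Ω e ε
    have h2 : Algebra.embeddingsMatrixReindex E Ω e ε = M'.map kb.val := by
      ext i j
      simp only [Algebra.embeddingsMatrixReindex, Matrix.reindex_apply, Matrix.submatrix_apply,
        Algebra.embeddingsMatrix_apply, Matrix.map_apply, M']
      exact (hτ j (e i)).symm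
    have h3 : (M'.map kb.val).det = 0 := by
      have := (kb.val.toRingHom.map_det M').symm
      rw [h0, map_zero] at this
      exact this
    rw [h2, h3] at h1
    have := Algebra.discr_not_zero_of_basis E e
    rw [zero_pow two_ne_zero, map_eq_zero] at h1
    exact this h1
  let N' := M'⁻¹
  have hMN : ∀ i k, ∑ j, τ j (e i) * (N' j k : Ω) = if i = k then 1 else 0 := by
    intro i k
    have h1 : M' * N' = 1 := Matrix.mul_nonsing_inv M' (isUnit_iff_ne_zero.mpr hdet)
    have h2 := congrArg (fun A : Matrix (Fin m) (Fin m) kb => kb.val (A i k)) h1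
    simp only [Matrix.mul_apply, map_sum, map_mul] at h2
    refine h2.trans ?_
    rw [Matrix.one_apply]
    split_ifs <;> simp
  have hN : ∀ j k, w (N' j k : Ω) ≤ 1 := fun j k =>
    hkle _ (mem_algebraicClosure_iff.mp (N' j k).2)
  let α : Fin m → Ω := fun k => ∑ j, τ j a * (N' j k : Ω)
  have hα : ∀ (c : E') k, w (α k - (e.repr c k : Ω)) ≤ w (a - c) := by
    intro c k
    have h1 : ((e.repr c k : E) : Ω) = ∑ j, τ j c * (N' j k : Ω) := by
      have hc : (c : Ω) = ∑ i, (e.repr c i : Ω) * e i := by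
        conv_lhs => rw [← e.sum_repr c]
        rw [← IntermediateField.coe_val, map_sum]
        exact Finset.sum_congr rfl fun i _ => by rw [map_smul, Algebra.smul_def]; rfl
      have hfix : ∀ j i, τ j (e.repr c i : Ω) = (e.repr c i : Ω) := fun j i =>
        (τ j).commutes (e.repr c i)
      have : ∀ j, τ j c * (N' j k : Ω) =
          ∑ i, (e.repr c i : Ω) * (τ j (e i) * (N' j k : Ω)) := by
        intro j
        rw [hc, map_sum, Finset.sum_mul]
        exact Finset.sum_congr rfl fun i _ => by rw [map_mul, hfix, mul_assoc]
      simp_rw [this]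
      rw [Finset.sum_comm]
      simp_rw [← Finset.mul_sum, hMN]
      simp
    rw [h1, ← Finset.sum_sub_distrib]
    refine Valuation.map_sum_le _ fun j _ => ?_
    rw [← sub_mul, ← map_sub, map_mul, hinv]
    exact mul_le_of_le_one_right' (hN j k)
  choose β hβE hβ using fun k => hE.best hmax (α k)
  let b : E' := ∑ k, (⟨β k, hβE k⟩ : E) • e k
  have hbr : ∀ k, e.repr b k = ⟨β k, hβE k⟩ := fun k => by
    simp only [b, e.repr_sum_self]
  have hbest : ∀ c : E', w (a - b) ≤ w (a - c) := by
    intro c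
    have h1 : w ((b : Ω) - c) ≤ w (a - c) := by
      have h2 : (b : Ω) - c = ∑ k, (β k - (e.repr c k : Ω)) * e k := by
        have h3 : b - c = ∑ k, (⟨β k, hβE k⟩ - e.repr c k) • e k := by
          simp_rw [sub_smul]
          rw [Finset.sum_sub_distrib, e.sum_repr]
        have := congrArg E'.val h3
        rw [map_sub] at this
        refine this.trans ((map_sum E'.val _ _).trans (Finset.sum_congr rfl fun i _ => ?_))
        rw [map_smul, Algebra.smul_def]; rfl
      rw [h2]
      refine Valuation.map_sum_le _ fun k _ => ?_
      rw [map_mul]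
      refine (mul_le_of_le_one_right' (hkle _ (he k).1)).trans ?_
      have h4 : β k - (e.repr c k : Ω) = (α k - e.repr c k) - (α k - β k) := by ring
      rw [h4]
      exact w.map_sub_le (hα c k) ((hβ k _ (e.repr c k).2).trans (hα c k))
    have h5 : a - b = (a - c) - (b - c) := by ring
    rw [h5]
    exact w.map_sub_le le_rfl h1
  have hab : a = b := by
    by_contra hne
    obtain ⟨d, hd, hdw⟩ := hE.value hmax (a - b) (sub_ne_zero.mpr hne)
    have hab0 : w (a - b) ≠ 0 := by simpa using sub_ne_zero.mpr hne
    have hd0 : d ≠ 0 := by rintro rfl; rw [map_zero] at hdw; exact hab0 hdw.symm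
    let u := (a - b) / d
    have huM : u ∈ M := div_mem (sub_mem haM (hE'M b.2)) (M.algebraMap_mem ⟨d, hd⟩)
    have hu1 : w u ≤ 1 := by rw [map_div₀, hdw, div_self hab0]
    obtain ⟨r, hr, hur⟩ := exists_rho w hK hF u hu1
    have hrM : r ∈ M := by
      rw [← InfiniteGalois.fixedField_fixingSubgroup M, IntermediateField.mem_fixedField_iff]
      intro g hg
      refine rho_unique hK (isAlgebraic_gal g hr) hr ?_
      have hgu : g u = u := (IntermediateField.mem_fixingSubgroup_iff _ _).mp hg u huM
      have h1 : w (u - g r) < 1 := by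
        rw [← hgu, ← map_sub, hinv]; exact hur
      have : g r - r = (u - r) - (u - g r) := by ring
      rw [this]
      exact w.map_sub_lt hur h1
    have hrE' : r ∈ E' := IntermediateField.subset_adjoin E n ⟨hr, hrM⟩
    have h2 := hbest (b + ⟨d, E'.algebraMap_mem ⟨d, hd⟩⟩ * ⟨r, hrE'⟩)
    have h3 : a - (b + d * r) = d * (u - r) := by
      simp only [u]; field_simp; ring
    have h4 : w (a - b) ≤ w (d * (u - r)) := by rw [← h3]; exact h2
    rw [map_mul, hdw] at h4
    exact absurd h4 (not_le.mpr (mul_lt_of_lt_one_right (zero_lt_iff.mpr hab0) hur))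
  rw [hab]
  exact IntermediateField.adjoin.mono E _ _ (fun x hx => hx.1) b.2
end
end

section
open Polynomial
set_option linter.unusedSectionVars false
section
section res
variable (k k' L L' : Type*) [Field k] [Field k'] [Field L] [Field L'] [Algebra k L]
  [Algebra k k'] [Algebra k' L'] [Algebra k L'] [IsScalarTower k k' L'] [Algebra L L']
  [IsScalarTower k L L'] [Normal k L]

/-- restriction of automorphisms -/
noncomputable def galRes : (L' ≃ₐ[k'] L') →* (L ≃ₐ[k] L) :=
  (AlgEquiv.restrictNormalHom L).comp (AlgEquiv.restrictScalarsHom k)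

theorem galRes_commutes (σ : L' ≃ₐ[k'] L') (x : L) :
    algebraMap L L' (galRes k k' L L' σ x) = σ (algebraMap L L' x) :=
  AlgEquiv.restrictNormal_commutes (σ.restrictScalars k) L x

theorem galRes_continuous : Continuous (galRes k k' L L') := by
  apply continuous_of_continuousAt_one _ (continuousAt_def.mpr _)
  intro N hN
  rw [map_one, krullTopology_mem_nhds_one_iff] at hN
  obtain ⟨M, hM, hO⟩ := hN
  rw [krullTopology_mem_nhds_one_iff]
  have hMe : Algebra.EssFiniteType k M := inferInstance
  obtain ⟨s, hs⟩ := IntermediateField.essFiniteType_iff.mp hMe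
  refine ⟨IntermediateField.adjoin k' (Set.image (algebraMap L L') (s : Set L)), ?_, ?_⟩
  · have : Finite (Set.image (algebraMap L L') (s : Set L)) := (s.finite_toSet.image _).to_subtype
    apply IntermediateField.finiteDimensional_adjoin
    rintro _ ⟨x, -, rfl⟩
    have h1 : IsIntegral k x := Normal.isIntegral inferInstance x
    exact (h1.map (IsScalarTower.toAlgHom k L L')).tower_top
  · intro σ hσ
    apply hO
    have hσ' := (IntermediateField.mem_fixingSubgroup_iff _ _).mp hσ
    refine (IntermediateField.mem_fixingSubgroup_iff _ _).mpr ?_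
    rw [← hs]
    intro x hx
    refine (IntermediateField.forall_mem_adjoin_smul_eq_self_iff k (S := (s : Set L))
      (galRes k k' L L' σ)).mpr ?_ x hx
    intro y hy
    apply (algebraMap L L').injective
    exact (galRes_commutes k k' L L' σ y).trans
      (hσ' _ (IntermediateField.subset_adjoin _ _ ⟨y, hy, rfl⟩))
end res

theorem exists_valuation_ext {F Ω Γ : Type*} [Field F] [Field Ω] [Algebra F Ω]
    [LinearOrderedCommGroupWithZero Γ] (v : Valuation F Γ) :
    ∃ O : ValuationSubring Ω,
      (∀ x : F, v x ≤ 1 → O.valuation (algebraMap F Ω x) ≤ 1) ∧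
      (∀ y : v.valuationSubring, y ∈ IsLocalRing.maximalIdeal v.valuationSubring →
        O.valuation (algebraMap F Ω y) < 1) ∧
      (∀ x : F, O.valuation (algebraMap F Ω x) ≤ 1 → v x ≤ 1) := by
  obtain ⟨O, h, hloc⟩ := IsLocalRing.exists_factor_valuationRing
    ((algebraMap F Ω).comp v.valuationSubring.subtype)
  have h2 : ∀ y : v.valuationSubring, y ∈ IsLocalRing.maximalIdeal v.valuationSubring →
        O.valuation (algebraMap F Ω y) < 1 := by
    intro y hy
    have h3 : (⟨_, h y⟩ : O) ∈ IsLocalRing.maximalIdeal O := by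
      rw [IsLocalRing.mem_maximalIdeal] at hy ⊢
      intro hu
      exact hy (hloc.map_nonunit y hu)
    exact (O.valuation_lt_one_iff _).mp h3
  refine ⟨O, fun x hx => (O.valuation_le_one_iff _).mpr (h ⟨x, hx⟩), h2, fun x hx => ?_⟩
  by_contra! hc
  have hx0 : v x ≠ 0 := (zero_lt_one.trans hc).ne'
  have hi : v x⁻¹ < 1 := by rw [map_inv₀]; exact inv_lt_one_of_one_lt₀ hc
  have h4 := h2 ⟨x⁻¹, hi.le⟩ (by
    rw [IsLocalRing.mem_maximalIdeal]
    intro hu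
    obtain ⟨u, hu⟩ := hu.exists_right_inv
    have h5 : x⁻¹ * u.1 = 1 := congrArg Subtype.val hu
    have h6 : v u.1 ≤ 1 := u.2
    have h7 := congrArg v h5
    rw [map_mul, map_one] at h7
    exact absurd h7 ((mul_le_of_le_one_right' h6).trans_lt hi).ne)
  have h8 : O.valuation (algebraMap F Ω x) ≠ 0 := by
    have : x ≠ 0 := by simpa using hx0
    simpa using this
  simp only [map_inv₀] at h4
  exact absurd ((inv_lt_one₀ (zero_lt_iff.mpr h8)).mp h4) (not_lt.mpr hx)

theorem section_aux {K F Ω Γ₀ Ks Fs : Type*} [Field K] [Field F] [Field Ω] [Algebra K F] [Algebra F Ω]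
    [Algebra K Ω] [IsScalarTower K F Ω] [IsAlgClosed Ω] [Algebra.IsAlgebraic F Ω]
    [LinearOrderedCommGroupWithZero Γ₀] (w : Valuation Ω Γ₀)
    (hK : ∀ a : K, a ≠ 0 → w (algebraMap K Ω a) = 1)
    (hF : ∀ x : F, w (algebraMap F Ω x) ≤ 1 →
      ∃ a : K, w (algebraMap F Ω x - algebraMap K Ω a) < 1)
    [Field Ks] [Algebra K Ks] [IsSepClosure K Ks]
    [Field Fs] [Algebra F Fs] [IsSepClosure F Fs]
    [Algebra K Fs] [IsScalarTower K F Fs] [Algebra Ks Fs] [IsScalarTower K Ks Fs]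
    [Algebra Ks Ω] [Algebra Fs Ω] [IsScalarTower F Fs Ω] [IsScalarTower K Ks Ω]
    [IsScalarTower Ks Fs Ω] :
    ∃ s : (Ks ≃ₐ[K] Ks) →* (Fs ≃ₐ[F] Fs), Continuous s ∧ ∀ τ, galRes K F Ks Fs (s τ) = τ := by
  obtain ⟨E, hE, hmax⟩ := exists_maximal_ResPI (K := K) w hF
  have hgal := hE.isGalois hmax
  have : IsScalarTower K E Ω := IsScalarTower.of_algebraMap_eq fun x => rfl
  have : IsSepClosed Ks := IsSepClosure.sep_closed K
  let R := galRes K E Ks Ω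
  have hRc : Continuous R := galRes_continuous K E Ks Ω
  have hR : ∀ σ x, algebraMap Ks Ω (R σ x) = σ (algebraMap Ks Ω x) := galRes_commutes K E Ks Ω
  have hinj : Function.Injective R := by
    rw [injective_iff_map_eq_one]
    intro σ hσ
    have hKs : ∀ x : Ks, σ (algebraMap Ks Ω x) = algebraMap Ks Ω x := fun x => by
      rw [← hR, hσ]; rfl
    have hkb : ∀ b : Ω, IsAlgebraic K b → σ b = b := by
      intro b hb
      obtain ⟨q, hq⟩ := ExpChar.exists Ks
      have : ExpChar Ω q := expChar_of_injective_algebraMap (algebraMap Ks Ω).injective q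
      have hb' : IsAlgebraic Ks b := hb.tower_top Ks
      let L := algebraicClosure Ks Ω
      have : IsPurelyInseparable Ks L := inferInstance
      obtain ⟨n, y, hy⟩ := IsPurelyInseparable.pow_mem Ks q
        (⟨b, mem_algebraicClosure_iff.mpr hb'⟩ : L)
      have hy' : algebraMap Ks Ω y = b ^ q ^ n := congrArg Subtype.val hy
      have h1 : (σ b) ^ q ^ n = b ^ q ^ n := by rw [← map_pow, ← hy', hKs]
      exact iterateFrobenius_inj Ω q n h1
    ext a
    have ha := hE.mem_adjoin_const hK hF hmax a
    exact (IntermediateField.forall_mem_adjoin_smul_eq_self_iff E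
      (S := {b : Ω | IsAlgebraic K b}) σ).mpr (fun b hb => hkb b hb) a ha
  have hsurj : Function.Surjective R := by
    have hcl : IsClosed (R.range : Set (Ks ≃ₐ[K] Ks)) := by
      rw [MonoidHom.coe_range]
      exact (isCompact_range hRc).isClosed
    have h1 := InfiniteGalois.fixingSubgroup_fixedField
      (⟨R.range, hcl⟩ : ClosedSubgroup (Ks ≃ₐ[K] Ks))
    have h2 : IntermediateField.fixedField R.range = ⊥ := by
      rw [eq_bot_iff]
      intro x hx
      have hfix : ∀ σ, R σ x = x := fun σ => hx ⟨R σ, σ, rfl⟩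
      have h3 : algebraMap Ks Ω x ∈ E := by
        have : algebraMap Ks Ω x ∈ Set.range (algebraMap E Ω) := by
          rw [InfiniteGalois.mem_range_algebraMap_iff_fixed]
          intro σ
          rw [← hR, hfix]
        obtain ⟨e, he⟩ := this
        rw [← he]; exact e.2
      have h4 : IsAlgebraic K (algebraMap Ks Ω x) :=
        (Algebra.IsAlgebraic.isAlgebraic (R := K) x).algHom (IsScalarTower.toAlgHom K Ks Ω)
      have h5 := hE.mem_perfectClosure hK h4 h3
      have h6 := (map_mem_perfectClosure_iff (IsScalarTower.toAlgHom K Ks Ω)).mp h5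
      rwa [perfectClosure.eq_bot_of_isSeparable] at h6
    change IntermediateField.fixingSubgroup (IntermediateField.fixedField R.range) = R.range at h1
    rw [h2, IntermediateField.fixingSubgroup_bot] at h1
    exact MonoidHom.range_eq_top.mp h1.symm
  let Re := MulEquiv.ofBijective R ⟨hinj, hsurj⟩
  have hRec : Continuous Re.symm :=
    Continuous.continuous_symm_of_equiv_compact_to_t2 (f := Re.toEquiv) hRc
  refine ⟨(galRes F E Fs Ω).comp Re.symm.toMonoidHom,
    (galRes_continuous F E Fs Ω).comp hRec, fun τ => ?_⟩
  obtain ⟨σ, rfl⟩ := hsurj τ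
  have h1 : Re.symm (R σ) = σ := Re.symm_apply_apply σ
  change galRes K F Ks Fs (galRes F E Fs Ω (Re.symm (R σ))) = R σ
  rw [h1]
  ext x
  apply (algebraMap Ks Ω).injective
  rw [hR, IsScalarTower.algebraMap_apply Ks Fs Ω, galRes_commutes, galRes_commutes,
    ← IsScalarTower.algebraMap_apply Ks Fs Ω]
end
end

theorem stmt12 (K F : Type) [Field K] [Field F] [Algebra K F]
    {Γ : Type} [LinearOrderedCommGroupWithZero Γ] (v : Valuation F Γ)
    -- `v` is trivial on `K`
    (htriv : ∀ x : K, x ≠ 0 → v (algebraMap K F x) = 1)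
    -- the residue field of `v` equals `K`, via the restriction of the residue map to `K`
    (hres : ∀ y : ↥v.valuationSubring, ∃ (x : K) (hx : algebraMap K F x ∈ v.valuationSubring),
      IsLocalRing.residue ↥v.valuationSubring ⟨algebraMap K F x, hx⟩ =
        IsLocalRing.residue ↥v.valuationSubring y)
    (Ks : Type) [Field Ks] [Algebra K Ks] [IsSepClosure K Ks]
    (Fs : Type) [Field Fs] [Algebra F Fs] [IsSepClosure F Fs]
    [Algebra K Fs] [IsScalarTower K F Fs] [Algebra Ks Fs] [IsScalarTower K Ks Fs] :
    ∃ r : (Fs ≃ₐ[F] Fs) →* (Ks ≃ₐ[K] Ks),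
      (∀ (σ : Fs ≃ₐ[F] Fs) (x : Ks), algebraMap Ks Fs (r σ x) = σ (algebraMap Ks Fs x)) ∧
      Continuous r ∧ Function.Surjective r ∧
      ∃ s : (Ks ≃ₐ[K] Ks) →* (Fs ≃ₐ[F] Fs), Continuous s ∧ ∀ τ, r (s τ) = τ := by
  have : Algebra.IsAlgebraic F (AlgebraicClosure Fs) := Algebra.IsAlgebraic.trans F Fs _
  obtain ⟨O, hle, hlt, hge⟩ := exists_valuation_ext (Ω := AlgebraicClosure Fs) v
  have hK : ∀ a : K, a ≠ 0 → O.valuation (algebraMap K (AlgebraicClosure Fs) a) = 1 := by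
    have h1 : ∀ a : K, a ≠ 0 → O.valuation (algebraMap K (AlgebraicClosure Fs) a) ≤ 1 := by
      intro a ha
      rw [IsScalarTower.algebraMap_apply K F (AlgebraicClosure Fs)]
      exact hle _ (htriv a ha).le
    intro a ha
    refine le_antisymm (h1 a ha) ?_
    have h2 := h1 a⁻¹ (inv_ne_zero ha)
    rw [map_inv₀, map_inv₀] at h2
    have h3 : O.valuation (algebraMap K (AlgebraicClosure Fs) a) ≠ 0 := by simpa using ha
    exact (inv_le_one₀ (zero_lt_iff.mpr h3)).mp h2
  have hF : ∀ x : F, O.valuation (algebraMap F (AlgebraicClosure Fs) x) ≤ 1 →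
      ∃ a : K, O.valuation (algebraMap F (AlgebraicClosure Fs) x -
        algebraMap K (AlgebraicClosure Fs) a) < 1 := by
    intro x hx
    obtain ⟨a, ha, hax⟩ := hres ⟨x, hge x hx⟩
    refine ⟨a, ?_⟩
    have h1 := hlt _ (Ideal.Quotient.eq.mp hax.symm)
    rw [IsScalarTower.algebraMap_apply K F (AlgebraicClosure Fs), ← map_sub]
    exact h1
  obtain ⟨s, hs, hrs⟩ := section_aux (Ks := Ks) (Fs := Fs) O.valuation hK hF
  exact ⟨galRes K F Ks Fs, galRes_commutes K F Ks Fs, galRes_continuous K F Ks Fs,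
    fun τ => ⟨s τ, hrs τ⟩, s, hs, hrs⟩
end

section
/- Let F/K be a purely transcendental field extension. Then the restriction map res : G(F) → G(K) on absolute Galois groups is a continuous epimorphism which has a continuous group-theoretic section. -/
namespace HahnClosed

variable {Γ L : Type} [AddCommGroup Γ] [LinearOrder Γ] [IsOrderedAddMonoid Γ] [Field L]

/-- The valuation ring of the Hahn series field. -/
def O (Γ L : Type) [AddCommGroup Γ] [LinearOrder Γ] [IsOrderedAddMonoid Γ] [Field L] :
    Subring (HahnSeries Γ L) where
  carrier := {x | ∀ γ < 0, x.coeff γ = 0}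
  mul_mem' := by
    intro a b ha hb γ hγ
    rw [HahnSeries.coeff_mul]
    refine Finset.sum_eq_zero ?_
    rintro ⟨i, j⟩ hij
    rw [Finset.mem_antidiagonal] at hij
    obtain ⟨h1, h2, h3⟩ := hij
    exfalso
    have hi : 0 ≤ i := not_lt.1 fun h => h1 (ha i h)
    have hj : 0 ≤ j := not_lt.1 fun h => h2 (hb j h)
    have : 0 ≤ i + j := add_nonneg hi hj
    simp only at h3
    rw [h3] at this
    exact absurd hγ (not_lt.2 this)
  one_mem' := by
    intro γ hγ
    rw [HahnSeries.coeff_one, if_neg hγ.ne]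
  add_mem' := by
    intro a b ha hb γ hγ
    rw [HahnSeries.coeff_add, ha γ hγ, hb γ hγ, add_zero]
  zero_mem' := by
    intro γ _
    rfl
  neg_mem' := by
    intro a ha γ hγ
    rw [HahnSeries.coeff_neg, ha γ hγ, neg_zero]

theorem mem_O {x : HahnSeries Γ L} : x ∈ O Γ L ↔ ∀ γ < 0, x.coeff γ = 0 := Iff.rfl

/-- The residue map. -/
def res : O Γ L →+* L where
  toFun x := x.1.coeff 0
  map_one' := by simp
  map_zero' := rfl
  map_add' x y := rfl
  map_mul' := by
    rintro ⟨a, ha⟩ ⟨b, hb⟩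
    change (a * b).coeff 0 = a.coeff 0 * b.coeff 0
    rw [HahnSeries.coeff_mul, Finset.sum_eq_single (0, 0)]
    · rintro ⟨i, j⟩ hij hne
      rw [Finset.mem_antidiagonal] at hij
      obtain ⟨h1, h2, h3⟩ := hij
      exfalso
      have hi : 0 ≤ i := not_lt.1 fun h => h1 (ha i h)
      have hj : 0 ≤ j := not_lt.1 fun h => h2 (hb j h)
      have := (add_eq_zero_iff_of_nonneg hi hj).1 h3
      exact hne (Prod.ext this.1 this.2)
    · intro h
      by_contra hne
      refine h ?_
      rw [Finset.mem_antidiagonal]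
      exact ⟨left_ne_zero_of_mul hne, right_ne_zero_of_mul hne, add_zero 0⟩

theorem res_apply (x : O Γ L) : res x = x.1.coeff 0 := rfl

open Polynomial
open HahnSeries (single coeff_single_mul single_mul_single single_pow coeff_single_of_ne coeff_single_same mem_support coeff_order_eq_zero coeff_eq_zero_of_lt_order)

/-- rescaled polynomial `t^e p(x + t^r X)` -/
noncomputable def scaled (p : (HahnSeries Γ L)[X]) (x : HahnSeries Γ L) (e r : Γ) :
    (HahnSeries Γ L)[X] :=
  C (single e 1) * p.comp (C (single r 1) * X + C x)

theorem coeff_scaled (p : (HahnSeries Γ L)[X]) (x : HahnSeries Γ L) (e r : Γ) (i : ℕ) :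
    (scaled p x e r).coeff i = single (e + i • r) 1 * (taylor x p).coeff i := by
  have : p.comp (C (single r 1) * X + C x) = (taylor x p).comp (C (single r 1) * X) := by
    rw [taylor_apply, comp_assoc]
    simp
  rw [scaled, this, coeff_C_mul, comp_C_mul_X_coeff, single_pow, one_pow, mul_comm (coeff _ _),
    ← mul_assoc, single_mul_single, one_mul]

theorem scaled_add (p : (HahnSeries Γ L)[X]) (x : HahnSeries Γ L) (e r : Γ) (u : HahnSeries Γ L) :
    scaled p (x + single r 1 * u) e r = (scaled p x e r).comp (X + C u) := by
  have key : C (single r (1 : L)) * X + C (x + single r 1 * u)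
      = C (single r (1 : L)) * (X + C u) + C x := by
    rw [C_add, C_mul]
    ring
  simp only [scaled, mul_comp, C_comp, comp_assoc, add_comp, X_comp]
  rw [key]

/-- `r` is the distance scale of `x` to the roots of `p`. -/
def Good (p : (HahnSeries Γ L)[X]) (x : HahnSeries Γ L) (r : Γ) : Prop :=
  ∃ (e : Γ) (Q : (O Γ L)[X]), Q.map (O Γ L).subtype = scaled p x e r ∧
    (Q.map res).coeff 0 ≠ 0 ∧ 1 ≤ (Q.map res).natDegree

theorem Good.compare {p : (HahnSeries Γ L)[X]} {z : HahnSeries Γ L} {r' : Γ} (h : Good p z r')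
    {e r : Γ} {Q : (O Γ L)[X]} (hQ : Q.map (O Γ L).subtype = scaled p z e r)
    (hd : 1 ≤ (Q.map res).natDegree) :
    r ≤ r' ∧ ((Q.map res).coeff 0 = 0 → r < r') := by
  obtain ⟨e', Q', hQ', h0, -⟩ := h
  have hc (i : ℕ) : (Q.coeff i).1 = single (e + i • r) 1 * (taylor z p).coeff i := by
    rw [← coeff_scaled, ← hQ, coeff_map]; rfl
  have hc' (i : ℕ) : (Q'.coeff i).1 = single (e' + i • r') 1 * (taylor z p).coeff i := by
    rw [← coeff_scaled, ← hQ', coeff_map]; rfl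
  have key (i : ℕ) (γ : Γ) : (Q.coeff i).1.coeff γ
      = (Q'.coeff i).1.coeff (γ - ((e - e') + i • (r - r'))) := by
    rw [hc, hc', coeff_single_mul, coeff_single_mul, smul_sub]
    congr 2
    abel
  have h1 : 0 ≤ e - e' := by
    by_contra hlt
    rw [not_le] at hlt
    apply h0
    rw [coeff_map, res_apply]
    have := key 0 (e - e')
    simp only [zero_smul, add_zero, sub_self] at this
    rw [← this]
    exact (Q.coeff 0).2 _ hlt
  have h1' : (Q.map res).coeff 0 = 0 → 0 < e - e' := by
    intro hz
    refine lt_of_le_of_ne h1 fun heq => h0 ?_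
    have := key 0 0
    simp only [← heq, zero_smul, add_zero, sub_self] at this
    rw [coeff_map, res_apply] at hz ⊢
    rw [← this, hz]
  obtain ⟨i, hi, hne⟩ : ∃ i : ℕ, 1 ≤ i ∧ (Q.map res).coeff i ≠ 0 := by
    refine ⟨_, hd, ?_⟩
    change leadingCoeff _ ≠ 0
    rw [leadingCoeff_ne_zero]
    rintro h
    rw [h] at hd
    simp at hd
  have h2 : (e - e') + i • (r - r') ≤ 0 := by
    by_contra hlt
    rw [not_le] at hlt
    apply hne
    rw [coeff_map, res_apply, key]
    exact (Q'.coeff i).2 _ (by rw [zero_sub]; exact neg_lt_zero.2 hlt)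
  constructor
  · by_contra hlt
    rw [not_le] at hlt
    have : 0 < i • (r - r') := nsmul_pos (sub_pos.2 hlt) (by omega)
    exact absurd h2 (not_le.2 (add_pos_of_nonneg_of_pos h1 this))
  · intro hz
    by_contra hlt
    rw [not_lt] at hlt
    have : 0 ≤ i • (r - r') := nsmul_nonneg (sub_nonneg.2 hlt) _
    exact absurd h2 (not_le.2 (add_pos_of_pos_of_nonneg (h1' hz) this))

theorem exists_good (hdiv : ∀ (n : ℕ) (γ : Γ), n ≠ 0 → ∃ δ : Γ, n • δ = γ)
    {p : (HahnSeries Γ L)[X]} (hp : 1 ≤ p.natDegree) {x : HahnSeries Γ L} (hx : p.eval x ≠ 0) :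
    ∃ r, Good p x r := by
  classical
  set a := taylor x p with ha
  have ha0 : a.coeff 0 ≠ 0 := by rwa [ha, taylor_coeff_zero]
  have hdeg : a.natDegree = p.natDegree := natDegree_taylor p x
  have hane : a ≠ 0 := by rintro h; rw [h] at ha0; simp at ha0
  have hδ : ∀ i : ℕ, ∃ δ : Γ, i ≠ 0 → i • δ = (a.coeff 0).order - (a.coeff i).order := by
    intro i
    by_cases hi : i = 0
    · exact ⟨0, fun h => absurd hi h⟩
    · obtain ⟨δ, h⟩ := hdiv i ((a.coeff 0).order - (a.coeff i).order) hi
      exact ⟨δ, fun _ => h⟩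
  choose δ hδ using hδ
  obtain ⟨i₀, hi₀, hmax⟩ := Finset.exists_max_image (a.support.erase 0) δ
    ⟨a.natDegree, by
      rw [Finset.mem_erase]
      exact ⟨by omega, natDegree_mem_support_of_nonzero hane⟩⟩
  rw [Finset.mem_erase, mem_support_iff] at hi₀
  have hO : ∀ i, single (-(a.coeff 0).order + i • δ i₀) 1 * a.coeff i ∈ O Γ L := by
    intro i γ hγ
    rw [coeff_single_mul, mul_eq_zero]
    right
    by_cases hai : a.coeff i = 0
    · rw [hai]; rfl
    · apply coeff_eq_zero_of_lt_order
      by_cases hi : i = 0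
      · subst hi
        simpa using hγ
      · have h1 := hδ i hi
        have h2 := hmax i (by rw [Finset.mem_erase, mem_support_iff]; exact ⟨hi, hai⟩)
        have h3 : i • δ i ≤ i • δ i₀ := nsmul_le_nsmul_right h2 i
        rw [h1] at h3
        rw [sub_lt_iff_lt_add]
        refine hγ.trans_le ?_
        have := sub_nonneg.2 h3
        refine this.trans (le_of_eq ?_)
        abel
  obtain ⟨Q, hQ⟩ : ∃ Q : (O Γ L)[X], Q.map (O Γ L).subtype
      = scaled p x (-(a.coeff 0).order) (δ i₀) := by
    have : scaled p x (-(a.coeff 0).order) (δ i₀) ∈ lifts (O Γ L).subtype := by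
      rw [lifts_iff_coeff_lifts]
      intro n
      rw [coeff_scaled]
      exact ⟨⟨_, hO n⟩, rfl⟩
    obtain ⟨Q, hQ⟩ := this
    exact ⟨Q, hQ⟩
  have hc (i : ℕ) : (Q.coeff i).1 = single (-(a.coeff 0).order + i • δ i₀) 1 * a.coeff i := by
    rw [← coeff_scaled, ← hQ, coeff_map]; rfl
  refine ⟨δ i₀, _, Q, hQ, ?_, ?_⟩
  · rw [coeff_map, res_apply, hc, coeff_single_mul]
    simp [coeff_order_eq_zero, ha0]
  · have : i₀ ≤ (Q.map res).natDegree := by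
      apply le_natDegree_of_ne_zero
      rw [coeff_map, res_apply, hc, coeff_single_mul, hδ i₀ hi₀.1]
      simp [coeff_order_eq_zero, hi₀.2]
    have := hi₀.1
    omega

theorem isAlgClosed [IsAlgClosed L] (hdiv : ∀ (n : ℕ) (γ : Γ), n ≠ 0 → ∃ δ : Γ, n • δ = γ) :
    IsAlgClosed (HahnSeries Γ L) := by
  classical
  apply IsAlgClosed.of_exists_root
  intro p hmon hirr
  by_contra! hno
  have hp : 1 ≤ p.natDegree := hirr.natDegree_pos
  choose r hr using fun x => exists_good hdiv hp (hno x)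
  let R : HahnSeries Γ L → HahnSeries Γ L → Prop := fun x y => ∀ γ < r x, y.coeff γ = x.coeff γ
  have hRO : ∀ x y, R x y → ∃ u : O Γ L, y = x + single (r x) 1 * u.1 := by
    intro x y h
    refine ⟨⟨single (-r x) 1 * (y - x), ?_⟩, ?_⟩
    · intro γ hγ
      rw [coeff_single_mul, HahnSeries.coeff_sub, h, sub_self, mul_zero]
      simpa using hγ
    · rw [← mul_assoc, single_mul_single]
      simp
  have hstep : ∀ x y, R x y → r x ≤ r y := by
    intro x y h
    obtain ⟨u, hu⟩ := hRO x y h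
    obtain ⟨e, Q, hQ, h0, hd⟩ := hr x
    refine ((hr y).compare (e := e) (r := r x) (Q := Q.comp (X + C u)) ?_ ?_).1
    · rw [hu, scaled_add, ← hQ, map_comp]
      simp
    · rw [map_comp, natDegree_comp]
      simpa using hd
  have hnext : ∀ x, ∃ c : L, c ≠ 0 ∧ r x < r (x + single (r x) c) := by
    intro x
    obtain ⟨e, Q, hQ, h0, hd⟩ := hr x
    obtain ⟨c, hc⟩ := IsAlgClosed.exists_root (Q.map res)
      (by intro h; have := natDegree_eq_zero_iff_degree_le_zero.2 h.le; omega)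
    have hcu : (single (0 : Γ) c) ∈ O Γ L := by
      intro γ hγ
      rw [coeff_single_of_ne hγ.ne]
    refine ⟨c, ?_, ?_⟩
    · rintro rfl
      rw [IsRoot, ← coeff_zero_eq_eval_zero] at hc
      exact h0 hc
    · refine ((hr _).compare (e := e) (r := r x) (Q := Q.comp (X + C ⟨_, hcu⟩)) ?_ ?_).2 ?_
      · have : single (r x) c = single (r x) 1 * single (0 : Γ) c := by
          rw [single_mul_single]; simp
        rw [this, scaled_add, ← hQ, map_comp]
        simp
      · rw [map_comp, natDegree_comp]
        simpa using hd
      · rw [coeff_zero_eq_eval_zero, map_comp, eval_comp]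
        have : res (⟨single (0 : Γ) c, hcu⟩ : O Γ L) = c := by
          rw [res_apply]; simp
        simpa [this] using hc
  obtain ⟨m, hm⟩ : ∃ m, ∀ a, R m a → R a m := by
    apply exists_maximal_of_chains_bounded
    · intro c hc
      let f : Γ → L := fun γ => if h : ∃ x ∈ c, γ < r x then (h.choose).coeff γ else 0
      have hf : ∀ x ∈ c, ∀ γ < r x, f γ = x.coeff γ := by
        intro x hx γ hγ
        have hex : ∃ x ∈ c, γ < r x := ⟨x, hx, hγ⟩
        have hfe : f γ = hex.choose.coeff γ := dif_pos hex
        obtain ⟨h1, h2⟩ := hex.choose_spec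
        rw [hfe]
        by_cases hxy : hex.choose = x
        · rw [hxy]
        · rcases hc h1 hx hxy with h | h
          · exact (h γ h2).symm
          · exact h γ hγ
      have hsupp : (Function.support f).IsPWO := by
        rw [Set.isPWO_iff_isWF, Set.isWF_iff_no_descending_seq]
        intro g hg hmem
        have hmem : ∀ n, g n ∈ Function.support f := fun n => hmem n
        have hex : ∃ x ∈ c, g 0 < r x := by
          by_contra h
          exact hmem 0 (dif_neg h)
        obtain ⟨x, hx, h0⟩ := hex
        refine (Set.isWF_iff_no_descending_seq.1 x.isWF_support) g hg fun n => ?_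
        have hlt : g n < r x := (hg.antitone (Nat.zero_le n)).trans_lt h0
        rw [mem_support, ← hf x hx _ hlt]
        exact hmem n
      exact ⟨⟨f, hsupp⟩, fun x hx γ hγ => hf x hx γ hγ⟩
    · intro x y z hxy hyz γ hγ
      rw [hyz γ (hγ.trans_le (hstep x y hxy)), hxy γ hγ]
  obtain ⟨c, hc, hlt⟩ := hnext m
  have h1 : R m (m + single (r m) c) := by
    intro γ hγ
    rw [HahnSeries.coeff_add, coeff_single_of_ne hγ.ne, add_zero]
  have h2 := hm _ h1 (r m) hlt
  rw [HahnSeries.coeff_add, coeff_single_same] at h2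
  exact hc (by simpa using h2)

end HahnClosed

namespace HahnClosed

theorem continuous_of_stab {G k E : Type} [Group G] [TopologicalSpace G] [IsTopologicalGroup G]
    [Field k] [Field E] [Algebra k E] (f : G →* (E ≃ₐ[k] E))
    (h : ∀ x : E, IsOpen {g | f g x = x}) : Continuous f := by
  apply continuous_of_continuousAt_one
  rw [ContinuousAt, map_one]
  intro s hs
  rw [krullTopology_mem_nhds_one_iff] at hs
  obtain ⟨M, hM, hs⟩ := hs
  obtain ⟨S, hS⟩ := IntermediateField.essFiniteType_iff.1 (inferInstance : Algebra.EssFiniteType k M)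
  rw [Filter.mem_map]
  have : (⋂ x ∈ S, {g | f g x = x}) ∈ nhds (1 : G) := by
    rw [Filter.biInter_finset_mem]
    intro x _
    exact (h x).mem_nhds (by simp)
  refine Filter.mem_of_superset this fun g hg => hs ?_
  simp only [Set.mem_iInter, Set.mem_ofPred_eq] at hg
  rw [SetLike.mem_coe, IntermediateField.mem_fixingSubgroup_iff, ← hS]
  have := (IntermediateField.forall_mem_adjoin_smul_eq_self_iff k (S := (S : Set E)) (f g)).2
    (fun x hx => hg x hx)
  exact this

theorem final (K F : Type) [Field K] [Field F] [Algebra K F]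
    (Ks : Type) [Field Ks] [Algebra K Ks] [IsSepClosure K Ks]
    (Fs : Type) [Field Fs] [Algebra F Fs] [IsSepClosure F Fs]
    [Algebra K Fs] [IsScalarTower K F Fs] [Algebra Ks Fs] [IsScalarTower K Ks Fs]
    (Ω : Type) [Field Ω] [IsAlgClosed Ω] [Algebra K Ω] [Algebra F Ω] [Algebra Ks Ω]
    [IsScalarTower K F Ω] [IsScalarTower K Ks Ω]
    (act : (Ks ≃ₐ[K] Ks) →* (Ω ≃ₐ[F] Ω))
    (hact : ∀ τ a, act τ (algebraMap Ks Ω a) = algebraMap Ks Ω (τ a))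
    (hcl : ∀ y : Ω, IsClosed {τ | act τ y = y}) :
    ∃ r : (Fs ≃ₐ[F] Fs) →* (Ks ≃ₐ[K] Ks),
      (∀ (σ : Fs ≃ₐ[F] Fs) (x : Ks), algebraMap Ks Fs (r σ x) = σ (algebraMap Ks Fs x)) ∧
      Continuous r ∧ Function.Surjective r ∧
      ∃ s : (Ks ≃ₐ[K] Ks) →* (Fs ≃ₐ[F] Fs), Continuous s ∧ ∀ τ, r (s τ) = τ := by
  have hGK : IsGalois K Ks := inferInstance
  have hGF : IsGalois F Fs := inferInstance
  have hN : Normal K Ks := inferInstance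
  have hNF : Normal F Fs := inferInstance
  let r : (Fs ≃ₐ[F] Fs) →* (Ks ≃ₐ[K] Ks) :=
    (AlgEquiv.restrictNormalHom (F := K) (K₁ := Fs) Ks).comp (AlgEquiv.restrictScalarsHom K)
  have hr : ∀ (σ : Fs ≃ₐ[F] Fs) (x : Ks),
      algebraMap Ks Fs (r σ x) = σ (algebraMap Ks Fs x) := fun σ x =>
    AlgEquiv.restrictNormal_commutes (σ.restrictScalars K) Ks x
  have hrc : Continuous r := by
    apply continuous_of_stab
    intro x
    have := stabilizer_isOpen_of_isIntegral (K := F) (algebraMap Ks Fs x)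
    convert this using 1
    ext σ
    change r σ x = x ↔ σ (algebraMap Ks Fs x) = algebraMap Ks Fs x
    rw [← hr]
    exact (algebraMap Ks Fs).injective.eq_iff.symm
  let j : Fs →ₐ[F] Ω := IsAlgClosed.lift
  let : Algebra Fs Ω := j.toRingHom.toAlgebra
  have : IsScalarTower F Fs Ω := IsScalarTower.of_algebraMap_eq fun x => (j.commutes x).symm
  have : IsScalarTower K Fs Ω := IsScalarTower.of_algebraMap_eq fun x => by
    rw [IsScalarTower.algebraMap_apply K F Ω, IsScalarTower.algebraMap_apply K F Fs,
      ← IsScalarTower.algebraMap_apply F Fs Ω]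
  let s₀ : (Ks ≃ₐ[K] Ks) →* (Fs ≃ₐ[F] Fs) :=
    (AlgEquiv.restrictNormalHom (F := F) (K₁ := Ω) Fs).comp act
  have hs₀ : ∀ τ y, algebraMap Fs Ω (s₀ τ y) = act τ (algebraMap Fs Ω y) := fun τ y =>
    AlgEquiv.restrictNormal_commutes (act τ) Fs y
  have hs₀c : Continuous s₀ := by
    apply continuous_of_stab
    intro y
    let H : Subgroup (Ks ≃ₐ[K] Ks) := (MulAction.stabilizer (Fs ≃ₐ[F] Fs) y).comap s₀
    have hH : {τ | s₀ τ y = y} = (H : Set (Ks ≃ₐ[K] Ks)) := rfl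
    rw [hH]
    have hcl' : IsClosed (H : Set (Ks ≃ₐ[K] Ks)) := by
      rw [← hH]
      convert hcl (algebraMap Fs Ω y) using 1
      ext τ
      change s₀ τ y = y ↔ act τ _ = _
      rw [← hs₀]
      exact (algebraMap Fs Ω).injective.eq_iff.symm
    have hfin : (MulAction.stabilizer (Fs ≃ₐ[F] Fs) y).FiniteIndex := by
      have := Subgroup.quotient_finite_of_isOpen _ (stabilizer_isOpen_of_isIntegral (K := F) y)
      exact Subgroup.finiteIndex_of_finite_quotient
    have : H.FiniteIndex := ⟨by
      rw [Subgroup.index_comap]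
      have := Subgroup.isFiniteRelIndex_of_finiteIndex
        (H := MulAction.stabilizer (Fs ≃ₐ[F] Fs) y) (K := s₀.range)
      exact Subgroup.relIndex_ne_zero⟩
    exact H.isOpen_of_isClosed_of_finiteIndex hcl'
  let φ : Ks →ₐ[K] Ω := (IsScalarTower.toAlgHom K Fs Ω).comp (IsScalarTower.toAlgHom K Ks Fs)
  let α : Ks ≃ₐ[K] Ks := AlgHom.restrictNormal' φ Ks
  have hα : ∀ x, algebraMap Ks Ω (α x) = algebraMap Fs Ω (algebraMap Ks Fs x) := fun x =>
    AlgHom.restrictNormal_commutes φ Ks x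
  have hrs : ∀ τ, r (s₀ τ) = α⁻¹ * τ * α := by
    intro τ
    have : α * r (s₀ τ) = τ * α := by
      ext x
      apply (algebraMap Ks Ω).injective
      rw [AlgEquiv.mul_apply, AlgEquiv.mul_apply, hα, hr, hs₀, ← hα, hact]
    rw [mul_assoc, ← this, inv_mul_cancel_left]
  let s : (Ks ≃ₐ[K] Ks) →* (Fs ≃ₐ[F] Fs) := s₀.comp (MulAut.conj α).toMonoidHom
  have hsc : Continuous s := by
    apply hs₀c.comp
    exact IsTopologicalGroup.continuous_conj α
  have hrs' : ∀ τ, r (s τ) = τ := by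
    intro τ
    change r (s₀ (α * τ * α⁻¹)) = τ
    rw [hrs]
    group
  exact ⟨r, hr, hrc, fun τ => ⟨s τ, hrs' τ⟩, s, hsc, hrs'⟩

end HahnClosed

namespace HahnClosed

theorem exists_lift (K Ks L : Type) [Field K] [Field Ks] [Algebra K Ks] [Field L] [Algebra Ks L]
    [IsSepClosed Ks] [IsAlgClosure Ks L] :
    ∃ f : (Ks ≃ₐ[K] Ks) →* (L ≃+* L), ∀ τ a, f τ (algebraMap Ks L a) = algebraMap Ks L (τ a) := by
  have : Algebra.IsAlgebraic Ks L := IsAlgClosure.isAlgebraic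
  have : IsPurelyInseparable Ks L := inferInstance
  let g : (Ks ≃ₐ[K] Ks) → (L ≃+* L) := fun τ => IsAlgClosure.equivOfEquiv L L τ.toRingEquiv
  have hg : ∀ τ a, g τ (algebraMap Ks L a) = algebraMap Ks L (τ a) := fun τ a =>
    IsAlgClosure.equivOfEquiv_algebraMap L L τ.toRingEquiv a
  refine ⟨MonoidHom.mk' g fun σ τ => ?_, hg⟩
  have h := IsPurelyInseparable.injective_comp_algebraMap Ks L L
    (a₁ := (g (σ * τ)).toRingHom) (a₂ := (g σ * g τ).toRingHom) (by
      ext a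
      change g (σ * τ) (algebraMap Ks L a) = g σ (g τ (algebraMap Ks L a))
      rw [hg, hg, hg]
      rfl)
  ext x
  exact RingHom.congr_fun h x

variable {Γ L : Type} [AddCommGroup Γ] [LinearOrder Γ] [IsOrderedAddMonoid Γ] [Field L]

/-- Coefficientwise action on Hahn series. -/
def mapEquiv (f : L ≃+* L) : HahnSeries Γ L ≃+* HahnSeries Γ L where
  toFun x := x.map f
  invFun x := x.map f.symm
  left_inv x := by ext γ; simp
  right_inv x := by ext γ; simp
  map_mul' x y := HahnSeries.map_mul (f : L →ₙ+* L)
  map_add' x y := HahnSeries.map_add (f : L →+ L)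

theorem coeff_mapEquiv (f : L ≃+* L) (x : HahnSeries Γ L) (γ : Γ) :
    (mapEquiv f x).coeff γ = f (x.coeff γ) := rfl

theorem algInd (K : Type) [Field K] [Algebra K L] (T : Type) (φ : (T →₀ ℕ) →+ Γ)
    (hφ : Function.Injective φ) :
    AlgebraicIndependent K
      (fun t : T => (HahnSeries.single (φ (Finsupp.single t 1)) (1 : L) : HahnSeries Γ L)) := by
  set y := (fun t : T => (HahnSeries.single (φ (Finsupp.single t 1)) (1 : L) : HahnSeries Γ L))
    with hy
  have hprod : ∀ m : T →₀ ℕ, m.prod (fun i k => y i ^ k) = HahnSeries.single (φ m) 1 := by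
    intro m
    induction m using Finsupp.induction_linear with
    | zero => simp
    | add a b ha hb =>
      rw [Finsupp.prod_add_index' (by simp) (by intros; rw [pow_add]), ha, hb,
        HahnSeries.single_mul_single, map_add, one_mul]
    | single t n =>
      rw [Finsupp.prod_single_index (by simp), hy]
      simp only [HahnSeries.single_pow, one_pow]
      rw [← map_nsmul]
      simp
  have hcoeff : ∀ (p : MvPolynomial T K) (m : T →₀ ℕ),
      (MvPolynomial.aeval y p).coeff (φ m) = algebraMap K L (p.coeff m) := by
    classical
    intro p m
    induction p using MvPolynomial.induction_on' with
    | monomial u a =>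
      rw [MvPolynomial.aeval_monomial, hprod, HahnSeries.algebraMap_apply, HahnSeries.C_apply,
        HahnSeries.single_mul_single, zero_add, mul_one, HahnSeries.coeff_single,
        MvPolynomial.coeff_monomial]
      by_cases h : u = m
      · simp [h]
      · rw [if_neg h, if_neg fun h' => h (hφ h').symm, map_zero]
    | add p q hp hq =>
      rw [map_add, HahnSeries.coeff_add, hp, hq, MvPolynomial.coeff_add, map_add]
  rw [algebraicIndependent_iff]
  intro p hp
  ext m
  have := hcoeff p m
  rw [hp, HahnSeries.coeff_zero] at this
  rw [MvPolynomial.coeff_zero]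
  exact ((map_eq_zero _).1 this.symm)

theorem exists_embedding (K F Ω : Type) [Field K] [Field F] [Algebra K F] [Field Ω] [Algebra K Ω]
    (T : Set F) (hT1 : AlgebraicIndependent K ((↑) : T → F))
    (hT2 : IntermediateField.adjoin K T = ⊤) (y : T → Ω) (hy : AlgebraicIndependent K y) :
    ∃ ι : F →ₐ[K] Ω, ∀ t : T, ι t = y t := by
  have hT : IntermediateField.adjoin K (Set.range ((↑) : T → F)) = ⊤ := by
    rw [Subtype.range_coe, hT2]
  let e : F ≃ₐ[K] FractionRing (MvPolynomial T K) :=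
    (IntermediateField.topEquiv.symm.trans (IntermediateField.equivOfEq hT.symm)).trans
      hT1.aevalEquivField.symm
  refine ⟨((IntermediateField.val _).comp hy.aevalEquivField.toAlgHom).comp e.toAlgHom, ?_⟩
  intro t
  have he : e t = algebraMap _ _ (MvPolynomial.X t : MvPolynomial T K) := by
    change hT1.aevalEquivField.symm _ = _
    rw [AlgEquiv.symm_apply_eq]
    apply Subtype.ext
    rw [AlgebraicIndependent.aevalEquivField_algebraMap_apply_coe, MvPolynomial.aeval_X]
    rfl
  change ((hy.aevalEquivField (e t) : IntermediateField.adjoin K (Set.range y)) : Ω) = y t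
  rw [he, AlgebraicIndependent.aevalEquivField_algebraMap_apply_coe, MvPolynomial.aeval_X]

theorem main_aux (K F : Type) [Field K] [Field F] [Algebra K F]
    (T : Set F) (hT1 : AlgebraicIndependent K ((↑) : T → F))
    (hT2 : IntermediateField.adjoin K T = ⊤)
    (Ks : Type) [Field Ks] [Algebra K Ks] [IsSepClosure K Ks]
    (Fs : Type) [Field Fs] [Algebra F Fs] [IsSepClosure F Fs]
    [Algebra K Fs] [IsScalarTower K F Fs] [Algebra Ks Fs] [IsScalarTower K Ks Fs]
    [IsSepClosed Ks] [Algebra K L] [Algebra Ks L] [IsScalarTower K Ks L] [IsAlgClosure Ks L]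
    (hdiv : ∀ (n : ℕ) (γ : Γ), n ≠ 0 → ∃ δ : Γ, n • δ = γ)
    (φ : (T →₀ ℕ) →+ Γ) (hφ : Function.Injective φ) :
    ∃ r : (Fs ≃ₐ[F] Fs) →* (Ks ≃ₐ[K] Ks),
      (∀ (σ : Fs ≃ₐ[F] Fs) (x : Ks), algebraMap Ks Fs (r σ x) = σ (algebraMap Ks Fs x)) ∧
      Continuous r ∧ Function.Surjective r ∧
      ∃ s : (Ks ≃ₐ[K] Ks) →* (Fs ≃ₐ[F] Fs), Continuous s ∧ ∀ τ, r (s τ) = τ := by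
  classical
  have : IsAlgClosed L := IsAlgClosure.isAlgClosed Ks
  have hΩ : IsAlgClosed (HahnSeries Γ L) := isAlgClosed hdiv
  obtain ⟨f, hf⟩ := exists_lift K Ks L
  have hfK : ∀ τ (a : K), f τ (algebraMap K L a) = algebraMap K L a := by
    intro τ a
    rw [IsScalarTower.algebraMap_apply K Ks L, hf, AlgEquiv.commutes]
  obtain ⟨ι, hι⟩ := exists_embedding K F (HahnSeries Γ L) T hT1 hT2 _ (algInd (L := L) K T φ hφ)
  let instF : Algebra F (HahnSeries Γ L) := ι.toRingHom.toAlgebra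
  have hKF : IsScalarTower K F (HahnSeries Γ L) := IsScalarTower.of_algebraMap_eq fun x => (ι.commutes x).symm
  have hKKs : IsScalarTower K Ks (HahnSeries Γ L) := IsScalarTower.of_algebraMap_eq fun x => by
    rw [HahnSeries.algebraMap_apply, HahnSeries.algebraMap_apply,
      IsScalarTower.algebraMap_apply K Ks L]
  have hC : ∀ τ (a : L), mapEquiv (Γ := Γ) (f τ) (HahnSeries.C a) = HahnSeries.C (f τ a) := by
    intro τ a
    ext γ
    rw [coeff_mapEquiv, HahnSeries.C_apply, HahnSeries.C_apply, HahnSeries.coeff_single,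
      HahnSeries.coeff_single]
    split_ifs <;> simp
  have hfix : ∀ τ (x : F), mapEquiv (f τ) (ι x) = ι x := by
    intro τ x
    have hx : x ∈ IntermediateField.adjoin K T := by rw [hT2]; trivial
    induction hx using IntermediateField.adjoin_induction with
    | mem t ht =>
      rw [hι ⟨t, ht⟩]
      ext γ
      rw [coeff_mapEquiv, HahnSeries.coeff_single]
      split_ifs <;> simp
    | algebraMap a =>
      rw [AlgHom.commutes, HahnSeries.algebraMap_apply, hC, hfK]
    | add x y _ _ hx hy => rw [map_add, map_add, hx, hy]
    | inv x _ hx => rw [map_inv₀, map_inv₀, hx]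
    | mul x y _ _ hx hy => rw [map_mul, map_mul, hx, hy]
  let act : (Ks ≃ₐ[K] Ks) →* ((HahnSeries Γ L) ≃ₐ[F] (HahnSeries Γ L)) :=
    MonoidHom.mk' (fun τ => AlgEquiv.ofRingEquiv (f := mapEquiv (f τ)) (hfix τ)) (by
      intro σ τ
      ext x γ
      change f (σ * τ) (x.coeff γ) = f σ (f τ (x.coeff γ))
      rw [map_mul]
      rfl)
  have hact : ∀ τ y γ, (act τ y).coeff γ = f τ (y.coeff γ) := fun τ y γ => rfl
  refine final K F Ks Fs (HahnSeries Γ L) act ?_ ?_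
  · intro τ a
    rw [HahnSeries.algebraMap_apply, HahnSeries.algebraMap_apply, ← hf]
    exact hC τ _
  · intro y
    have hset : {τ | act τ y = y} = ⋂ γ, {τ | f τ (y.coeff γ) = y.coeff γ} := by
      ext τ
      simp only [Set.mem_iInter, Set.mem_ofPred_eq]
      constructor
      · intro h γ
        rw [← hact, h]
      · intro h
        ext γ
        rw [hact, h]
    rw [hset]
    apply isClosed_iInter
    intro γ
    generalize y.coeff γ = a
    have : Algebra.IsAlgebraic Ks L := IsAlgClosure.isAlgebraic
    have : IsPurelyInseparable Ks L := inferInstance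
    let q := ringExpChar Ks
    have : ExpChar L q := expChar_of_injective_algebraMap (algebraMap Ks L).injective q
    obtain ⟨n, b, hb⟩ := IsPurelyInseparable.pow_mem Ks q a
    have hGK : IsGalois K Ks := inferInstance
    have h1 : IsClosed (MulAction.stabilizer (Ks ≃ₐ[K] Ks) b : Set (Ks ≃ₐ[K] Ks)) :=
      Subgroup.isClosed_of_isOpen _ (stabilizer_isOpen_of_isIntegral (K := K) b)
    convert h1 using 1
    ext τ
    change f τ a = a ↔ τ b = b
    rw [← (algebraMap Ks L).injective.eq_iff, ← hf, hb, map_pow]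
    constructor
    · intro h
      rw [h]
    · intro h
      exact iterateFrobenius_inj L q n h

end HahnClosed

open HahnClosed in
theorem stmt13 (K F : Type) [Field K] [Field F] [Algebra K F]
    -- `F/K` is purely transcendental: `F = K(T)` for an algebraically independent set `T`
    (T : Set F) (hT1 : AlgebraicIndependent K ((↑) : T → F))
    (hT2 : IntermediateField.adjoin K T = ⊤)
    (Ks : Type) [Field Ks] [Algebra K Ks] [IsSepClosure K Ks]
    (Fs : Type) [Field Fs] [Algebra F Fs] [IsSepClosure F Fs]
    [Algebra K Fs] [IsScalarTower K F Fs] [Algebra Ks Fs] [IsScalarTower K Ks Fs] :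
    ∃ r : (Fs ≃ₐ[F] Fs) →* (Ks ≃ₐ[K] Ks),
      (∀ (σ : Fs ≃ₐ[F] Fs) (x : Ks), algebraMap Ks Fs (r σ x) = σ (algebraMap Ks Fs x)) ∧
      Continuous r ∧ Function.Surjective r ∧
      ∃ s : (Ks ≃ₐ[K] Ks) →* (Fs ≃ₐ[F] Fs), Continuous s ∧ ∀ τ, r (s τ) = τ := by
  classical
  have : IsSepClosed Ks := IsSepClosure.sep_closed K
  let instT : LinearOrder T := linearOrderOfSTO WellOrderingRel
  let Γ := Lex (T →₀ ℚ)
  have hdiv : ∀ (n : ℕ) (γ : Γ), n ≠ 0 → ∃ δ : Γ, n • δ = γ := by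
    intro n γ hn
    refine ⟨toLex ((n : ℚ)⁻¹ • ofLex γ), ?_⟩
    apply ofLex.injective
    ext t
    change n • ((n : ℚ)⁻¹ * ofLex γ t) = ofLex γ t
    have : (n : ℚ) ≠ 0 := by exact_mod_cast hn
    rw [nsmul_eq_mul]
    field_simp
  let φ : (T →₀ ℕ) →+ Γ :=
    { toFun := fun m => toLex (m.mapRange (Nat.cast : ℕ → ℚ) Nat.cast_zero)
      map_zero' := by
        apply ofLex.injective
        ext t
        simp
      map_add' := by
        intro a b
        apply ofLex.injective
        ext t
        change ((a t + b t : ℕ) : ℚ) = (a t : ℚ) + (b t : ℚ)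
        exact Nat.cast_add _ _ }
  have hφ : Function.Injective φ := by
    intro a b h
    exact Finsupp.mapRange_injective _ _ Nat.cast_injective (toLex.injective h)
  exact main_aux (L := AlgebraicClosure Ks) K F T hT1 hT2 Ks Fs hdiv φ hφ
end
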